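/- arXiv:1909.01659 — 12 statements merged into one kernel-verified Lean document; each statement's English description precedes it below -/
import Mathlib

section
/- For every positive integer d and every natural number k, the k-th moment of the d-fold sum of independent arcsine-type variables equals a multinomial sum of central binomial coefficients: ∫_{[0,4]^d} (x_1 + ⋯ + x_d)^k ∏_{m=1}^d μ_Z(dx_m) = ∑_{k_1+⋯+k_d=k} (k! / (k_1! ⋯ k_d!)) ∏_{m=1}^d C(2k_m, k_m), where the sum runs over all d-tuples (k_1,…,k_d) of natural numbers with k_1+⋯+k_d=k and C(2k_m,k_m) denotes the central binomial coefficient. (This computes the special value ζ_{ℤ^d}(−k) of the spectral zeta function of the lattice ℤ^d.) -/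
open Real MeasureTheory

lemma hasDerivAt_four_mul_cos_sq (θ : ℝ) :
    HasDerivAt (fun t : ℝ => 4 * cos t ^ 2) (-(8 * cos θ * sin θ)) θ := by
  refine (((hasDerivAt_cos θ).fun_pow 2).const_mul 4).congr_deriv ?_
  push_cast
  ring

lemma injOn_four_mul_cos_sq :
    Set.InjOn (fun t : ℝ => 4 * cos t ^ 2) (Set.Ioo 0 (π / 2)) := by
  intro a ha b hb hab
  have ca : 0 < cos a := cos_pos_of_mem_Ioo ⟨by linarith [ha.1, pi_pos], ha.2⟩
  have cb : 0 < cos b := cos_pos_of_mem_Ioo ⟨by linarith [hb.1, pi_pos], hb.2⟩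
  have hsq : cos a ^ 2 = cos b ^ 2 := by
    dsimp only at hab
    linarith
  exact injOn_cos ⟨ha.1.le, by linarith [ha.2, pi_pos]⟩ ⟨hb.1.le, by linarith [hb.2, pi_pos]⟩
    ((sq_eq_sq₀ ca.le cb.le).1 hsq)

lemma image_four_mul_cos_sq :
    (fun t : ℝ => 4 * cos t ^ 2) '' Set.Ioo 0 (π / 2) = Set.Ioo 0 4 := by
  ext y
  constructor
  · rintro ⟨t, ht, rfl⟩
    have hc : 0 < cos t := cos_pos_of_mem_Ioo ⟨by linarith [ht.1, pi_pos], ht.2⟩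
    have hs : 0 < sin t := sin_pos_of_pos_of_lt_pi ht.1 (by linarith [ht.2, pi_pos])
    have := sin_sq_add_cos_sq t
    exact ⟨by positivity, by dsimp only; nlinarith [pow_pos hs 2]⟩
  · rintro ⟨h0, h4⟩
    have hpos : 0 < √(y / 4) := Real.sqrt_pos.2 (by linarith)
    have hlt : √(y / 4) < 1 := by
      rw [Real.sqrt_lt' one_pos]
      linarith
    refine ⟨arccos √(y / 4), ⟨arccos_pos.2 hlt, arccos_lt_pi_div_two.2 hpos⟩, ?_⟩
    dsimp only
    rw [cos_arccos (by linarith) hlt.le, Real.sq_sqrt (by linarith)]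
    ring

lemma abs_deriv_mul_arcsine_density {θ : ℝ} (hθ : θ ∈ Set.Ioo 0 (π / 2)) (n : ℕ) :
    |-(8 * cos θ * sin θ)| •
        ((4 * cos θ ^ 2) ^ n * (1 / (π * √(4 * cos θ ^ 2 * (4 - 4 * cos θ ^ 2))))) =
      2 / π * 4 ^ n * cos θ ^ (2 * n) := by
  have hc : 0 < cos θ := cos_pos_of_mem_Ioo ⟨by linarith [hθ.1, pi_pos], hθ.2⟩
  have hs : 0 < sin θ := sin_pos_of_pos_of_lt_pi hθ.1 (by linarith [hθ.2, pi_pos])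
  have hsq : 4 * cos θ ^ 2 * (4 - 4 * cos θ ^ 2) = (4 * cos θ * sin θ) ^ 2 := by
    have := sin_sq_add_cos_sq θ
    linear_combination (-16 * cos θ ^ 2) * this
  rw [hsq, Real.sqrt_sq (by positivity), abs_neg, abs_of_pos (by positivity), smul_eq_mul,
    mul_pow, ← pow_mul]
  have := pi_pos
  field_simp
  norm_num

lemma integrableOn_pow_mul_arcsine_density (n : ℕ) :
    IntegrableOn (fun x : ℝ => x ^ n * (1 / (π * √(x * (4 - x))))) (Set.Ioo 0 4) := by
  rw [← image_four_mul_cos_sq, integrableOn_image_iff_integrableOn_abs_deriv_smul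
    measurableSet_Ioo (fun t _ => (hasDerivAt_four_mul_cos_sq t).hasDerivWithinAt)
    injOn_four_mul_cos_sq, integrableOn_congr_fun
    (fun θ hθ => abs_deriv_mul_arcsine_density hθ n) measurableSet_Ioo]
  have hcont : Continuous fun θ : ℝ => 2 / π * 4 ^ n * cos θ ^ (2 * n) := by fun_prop
  exact (hcont.integrableOn_Icc).mono_set Set.Ioo_subset_Icc_self

lemma four_pow_mul_prod_odd_div_even (n : ℕ) :
    4 ^ n * ∏ i ∈ Finset.range n, (2 * (i : ℝ) + 1) / (2 * i + 2) = (n.centralBinom : ℝ) := by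
  induction n with
  | zero => simp
  | succ n ih =>
    have h : ((n : ℝ) + 1) * (n + 1).centralBinom = 2 * (2 * n + 1) * n.centralBinom := by
      exact_mod_cast Nat.succ_mul_centralBinom_succ n
    rw [Finset.prod_range_succ]
    have hn : (n : ℝ) + 1 ≠ 0 := by positivity
    apply mul_left_cancel₀ hn
    rw [h, ← ih]
    field_simp
    ring

lemma integral_pow_mul_arcsine_density (n : ℕ) :
    ∫ x in Set.Ioo (0 : ℝ) 4, x ^ n * (1 / (π * √(x * (4 - x)))) = ((2 * n).choose n : ℝ) := by
  rw [← image_four_mul_cos_sq, integral_image_eq_integral_abs_deriv_smul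
    measurableSet_Ioo (fun t _ => (hasDerivAt_four_mul_cos_sq t).hasDerivWithinAt)
    injOn_four_mul_cos_sq, setIntegral_congr_fun measurableSet_Ioo
    (fun θ hθ => abs_deriv_mul_arcsine_density hθ n), integral_const_mul,
    ← integral_Ioc_eq_integral_Ioo, ← intervalIntegral.integral_of_le (by positivity),
    EulerSine.integral_cos_pow_eq, integral_sin_pow_even, ← Nat.centralBinom_eq_two_mul_choose,
    ← four_pow_mul_prod_odd_div_even]
  have := pi_pos
  field_simp

/-- The special value `ζ_{ℤ^d}(−k)`: the `k`-th moment of the `d`-fold sum of independent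
arcsine-type variables with density `1/(π√(x(4−x)))` on `(0,4)` equals the multinomial sum
`∑_{k_1+⋯+k_d=k} (k!/(k_1!⋯k_d!)) ∏_m C(2k_m, k_m)`. -/
theorem zeta_Zd_neg_int (d : ℕ) (hd : 0 < d) (k : ℕ) :
    (∫ x in Set.univ.pi fun _ : Fin d => Set.Ioo (0 : ℝ) 4,
        (∑ m, x m) ^ k * ∏ m, (1 / (π * Real.sqrt (x m * (4 - x m)))))
      = ∑ κ ∈ Finset.Nat.antidiagonalTuple d k,
          (Nat.multinomial Finset.univ κ : ℝ) * ∏ m, ((2 * κ m).choose (κ m) : ℝ) := by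
  have hexpand : ∀ x : Fin d → ℝ,
      (∑ m, x m) ^ k * ∏ m, (1 / (π * √(x m * (4 - x m)))) =
        ∑ κ ∈ Finset.Nat.antidiagonalTuple d k, (Nat.multinomial Finset.univ κ : ℝ) *
          ∏ m, (x m ^ κ m * (1 / (π * √(x m * (4 - x m))))) := by
    intro x
    rw [Finset.sum_pow_eq_sum_piAntidiag, Finset.piAntidiag_univ_fin_eq_antidiagonalTuple,
      Finset.sum_mul]
    simp only [Finset.prod_mul_distrib, mul_assoc]
  simp_rw [hexpand]
  rw [volume_pi, Measure.restrict_pi_pi, integral_finsetSum]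
  · refine Finset.sum_congr rfl fun κ _ => ?_
    rw [integral_const_mul, integral_fintype_prod_eq_prod
      (f := fun m (y : ℝ) => y ^ κ m * (1 / (π * √(y * (4 - y)))))]
    simp only [integral_pow_mul_arcsine_density]
  · intro κ _
    exact (Integrable.fintype_prod
      (f := fun m (y : ℝ) => y ^ κ m * (1 / (π * √(y * (4 - y)))))
      fun m => integrableOn_pow_mul_arcsine_density (κ m)).const_mul _
end

section
/- For every natural number k, the following binomial identity holds: ∑_{l=0}^{k} C(k,l) · C(2l,l) · C(2k−2l,k−l) · (2l)! · (2k−2l)! = 2^k · (k!)^2 · ∑_{l=0}^{k} C(k,l) · C(2l,l) · C(2k−2l,k−l). (This identity is equivalent to the functional symmetry Res(ζ_{ℤ²}(z) | z = 1−s) = −(1/(π·2^{2−5s}))·ζ_{ℤ²}(s) at negative integers s = −k, relating the residues of the meromorphically continued spectral zeta function of ℤ² to its special values.) -/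
/-- The self-convolution `∑_{l ≤ n} f l * f (n - l)` of a sequence of rationals. -/
def selfConv (f : ℕ → ℚ) (n : ℕ) : ℚ := ∑ l ∈ Finset.range (n + 1), f l * f (n - l)

/-- A certificate `G` for creative telescoping yields a second-order recurrence for a
self-convolution, up to the boundary terms. -/
theorem selfConv_recurrence_of_telescoping (f : ℕ → ℚ) (n : ℕ) (p₂ p₁ p₀ : ℚ) (G : ℕ → ℚ)
    (h0 : G 0 = 0)
    (hG : ∀ l m, n = l + m →
      p₂ * (f l * f (m + 2)) + p₁ * (f l * f (m + 1)) + p₀ * (f l * f m) = G (l + 1) - G l) :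
    p₂ * selfConv f (n + 2) + p₁ * selfConv f (n + 1) + p₀ * selfConv f n =
      G (n + 1) + p₂ * (f (n + 1) * f 1 + f (n + 2) * f 0) + p₁ * (f (n + 1) * f 0) := by
  have key : ∑ l ∈ Finset.range (n + 1), (p₂ * (f l * f (n + 2 - l)) +
      p₁ * (f l * f (n + 1 - l)) + p₀ * (f l * f (n - l))) = G (n + 1) := by
    rw [← sub_zero (G (n + 1)), ← h0, ← Finset.sum_range_sub]
    refine Finset.sum_congr rfl fun l hl => ?_
    obtain ⟨m, rfl⟩ := Nat.exists_eq_add_of_le (Finset.mem_range_succ_iff.mp hl)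
    rw [← hG l m rfl]
    congr 5 <;> omega
  simp only [Finset.sum_add_distrib, ← Finset.mul_sum] at key
  have e1 : n + 2 - (n + 1) = 1 := by omega
  simp only [selfConv, Finset.sum_range_succ _ (n + 2), Finset.sum_range_succ _ (n + 1), e1,
    Nat.sub_self]
  linear_combination key

/-- The sequence `C(2l,l) / l!`. -/
def centralBinomDivFactorial (l : ℕ) : ℚ := l.centralBinom / l.factorial

/-- The sequence `l! * C(2l,l) ^ 2`. -/
def factorialMulCentralBinomSq (l : ℕ) : ℚ := l.factorial * l.centralBinom ^ 2

theorem cast_centralBinom_succ (l : ℕ) :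
    ((l + 1).centralBinom : ℚ) = 2 * (2 * l + 1) * l.centralBinom / (l + 1) := by
  rw [eq_div_iff (by positivity), mul_comm]
  exact_mod_cast Nat.succ_mul_centralBinom_succ l

theorem centralBinomDivFactorial_succ (l : ℕ) :
    centralBinomDivFactorial (l + 1) =
      2 * (2 * l + 1) / (l + 1) ^ 2 * centralBinomDivFactorial l := by
  simp only [centralBinomDivFactorial, cast_centralBinom_succ, Nat.factorial_succ]
  push_cast
  field_simp

theorem factorialMulCentralBinomSq_succ (l : ℕ) :
    factorialMulCentralBinomSq (l + 1) =
      4 * (2 * l + 1) ^ 2 / (l + 1) * factorialMulCentralBinomSq l := by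
  simp only [factorialMulCentralBinomSq, cast_centralBinom_succ, Nat.factorial_succ]
  push_cast
  field_simp
  ring

theorem selfConv_centralBinomDivFactorial_recurrence (n : ℕ) :
    (n + 2 : ℚ) ^ 3 * selfConv centralBinomDivFactorial (n + 2) =
      (12 * (n + 1) ^ 2 + 12 * (n + 1) + 4) * selfConv centralBinomDivFactorial (n + 1) -
        32 * (n + 1) * selfConv centralBinomDivFactorial n := by
  have h := selfConv_recurrence_of_telescoping centralBinomDivFactorial n ((n + 2) ^ 3)
    (-(12 * (n + 1) ^ 2 + 12 * (n + 1) + 4)) (32 * (n + 1))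
    (fun l => (2 * l * (n + 1) - (2 * n + 1) * (n + 2)) * l ^ 2 * 2 / (n + 2 - l) ^ 2 *
      (centralBinomDivFactorial l * centralBinomDivFactorial (n + 1 - l)))
    (by simp) (by
      rintro l m rfl
      have e1 : l + m + 1 - l = m + 1 := by omega
      have e2 : l + m + 1 - (l + 1) = m := by omega
      have e3 : ((l + m : ℕ) + 2 - l : ℚ) = m + 2 := by push_cast; ring
      have e4 : ((l + m : ℕ) + 2 - (l + 1 : ℕ) : ℚ) = m + 1 := by push_cast; ring
      simp only [e1, e2, e3, e4, centralBinomDivFactorial_succ]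
      push_cast
      field_simp
      ring)
  have b0 : centralBinomDivFactorial 0 = 1 := by simp [centralBinomDivFactorial]
  have e : ((n : ℚ) + 2 - (n + 1 : ℕ)) = 1 := by push_cast; ring
  simp only [e, Nat.sub_self, centralBinomDivFactorial_succ, b0] at h
  rw [← sub_eq_zero]
  refine Eq.trans (by ring) (h.trans ?_)
  push_cast
  field_simp
  ring

theorem selfConv_factorialMulCentralBinomSq_recurrence (n : ℕ) :
    (n + 2 : ℚ) * selfConv factorialMulCentralBinomSq (n + 2) =
      2 * (12 * (n + 1) ^ 2 + 12 * (n + 1) + 4) * selfConv factorialMulCentralBinomSq (n + 1) -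
        128 * (n + 1) ^ 3 * selfConv factorialMulCentralBinomSq n := by
  have h := selfConv_recurrence_of_telescoping factorialMulCentralBinomSq n (n + 2)
    (-(2 * (12 * (n + 1) ^ 2 + 12 * (n + 1) + 4))) (128 * (n + 1) ^ 3)
    (fun l => (28 + 32 * n + 8 * n ^ 2 - 16 * l - 8 * n * l) * l / (n + 2 - l) *
      (factorialMulCentralBinomSq l * factorialMulCentralBinomSq (n + 1 - l)))
    (by simp) (by
      rintro l m rfl
      have e1 : l + m + 1 - l = m + 1 := by omega
      have e2 : l + m + 1 - (l + 1) = m := by omega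
      have e3 : ((l + m : ℕ) + 2 - l : ℚ) = m + 2 := by push_cast; ring
      have e4 : ((l + m : ℕ) + 2 - (l + 1 : ℕ) : ℚ) = m + 1 := by push_cast; ring
      simp only [e1, e2, e3, e4, factorialMulCentralBinomSq_succ]
      push_cast
      field_simp
      ring)
  have c0 : factorialMulCentralBinomSq 0 = 1 := by simp [factorialMulCentralBinomSq]
  have e : ((n : ℚ) + 2 - (n + 1 : ℕ)) = 1 := by push_cast; ring
  simp only [e, Nat.sub_self, factorialMulCentralBinomSq_succ, c0] at h
  rw [← sub_eq_zero]
  refine Eq.trans (by ring) (h.trans ?_)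
  push_cast
  field_simp
  ring

theorem selfConv_factorialMulCentralBinomSq_eq (k : ℕ) :
    selfConv factorialMulCentralBinomSq k =
      2 ^ k * (k.factorial : ℚ) ^ 2 * selfConv centralBinomDivFactorial k := by
  induction k using Nat.twoStepInduction with
  | zero => simp [selfConv, factorialMulCentralBinomSq, centralBinomDivFactorial]
  | one =>
    norm_num [selfConv, factorialMulCentralBinomSq, centralBinomDivFactorial,
      Finset.sum_range_succ, Nat.centralBinom_eq_two_mul_choose]
  | more n ih₀ ih₁ =>
    have hb := selfConv_centralBinomDivFactorial_recurrence n
    have hc := selfConv_factorialMulCentralBinomSq_recurrence n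
    rw [ih₀, ih₁] at hc
    refine mul_left_cancel₀ (by positivity : (n + 2 : ℚ) ≠ 0) (hc.trans ?_)
    simp only [Nat.factorial_succ]
    push_cast
    linear_combination -(4 * 2 ^ n * (n + 1) ^ 2 * (n.factorial : ℚ) ^ 2) * hb


/-- The binomial identity equivalent to the functional symmetry
`Res(ζ_{ℤ²}(z) | z = 1−s) = −(1/(π·2^{2−5s}))·ζ_{ℤ²}(s)` at negative integers `s = −k`. -/
theorem zeta_Z2_functional_symmetry (k : ℕ) :
    ∑ l ∈ Finset.range (k + 1),
        k.choose l * (2 * l).choose l * (2 * (k - l)).choose (k - l)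
          * (2 * l).factorial * (2 * (k - l)).factorial
      = 2 ^ k * (k.factorial) ^ 2 *
          ∑ l ∈ Finset.range (k + 1),
            k.choose l * (2 * l).choose l * (2 * (k - l)).choose (k - l) := by
  have h := selfConv_factorialMulCentralBinomSq_eq k
  simp only [selfConv] at h
  have choose_eq : ∀ l ∈ Finset.range (k + 1),
      (k.choose l : ℚ) = k.factorial / (l.factorial * (k - l).factorial) := fun l hl =>
    Nat.cast_choose ℚ (Finset.mem_range_succ_iff.mp hl)
  have fact_eq (l : ℕ) :
      ((2 * l).factorial : ℚ) = (2 * l).choose l * (l.factorial : ℚ) ^ 2 := by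
    have := Nat.choose_mul_factorial_mul_factorial (show l ≤ 2 * l by omega)
    rw [show 2 * l - l = l by omega] at this
    rw [← this]
    push_cast
    ring
  rw [← Nat.cast_inj (R := ℚ)]
  push_cast
  calc _ = k.factorial * ∑ l ∈ Finset.range (k + 1),
        factorialMulCentralBinomSq l * factorialMulCentralBinomSq (k - l) := by
        rw [Finset.mul_sum]
        refine Finset.sum_congr rfl fun l hl => ?_
        rw [choose_eq l hl, fact_eq, fact_eq]
        simp only [factorialMulCentralBinomSq, Nat.centralBinom_eq_two_mul_choose]
        field_simp
    _ = _ := by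
        rw [h, ← mul_assoc, mul_comm (k.factorial : ℚ), mul_assoc, Finset.mul_sum]
        congr 1
        refine Finset.sum_congr rfl fun l hl => ?_
        rw [choose_eq l hl]
        simp only [centralBinomDivFactorial, Nat.centralBinom_eq_two_mul_choose]
        ring
end

section
/- For every real number x > 0, the regularized determinant of x + Δ_ℤ admits the closed form exp( ∫_0^4 log(x+y) / (π√(y(4−y))) dy ) = x/2 + 1 + (1/2)·√(x(x+4)). -/
open Real MeasureTheory

theorem image_two_sub_two_mul_cos_Ioo :
    (fun θ : ℝ => 2 - 2 * cos θ) '' Set.Ioo 0 π = Set.Ioo 0 4 := by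
  ext y
  constructor
  · rintro ⟨θ, ⟨h0, h1⟩, rfl⟩
    have hl := cos_lt_cos_of_nonneg_of_le_pi le_rfl h1.le h0
    have hr := cos_lt_cos_of_nonneg_of_le_pi h0.le le_rfl h1
    rw [cos_zero] at hl
    rw [cos_pi] at hr
    constructor <;> dsimp only <;> linarith
  · rintro ⟨h0, h4⟩
    refine ⟨arccos (1 - y / 2), ⟨arccos_pos.2 (by linarith), arccos_lt_pi.2 (by linarith)⟩, ?_⟩
    dsimp only
    rw [cos_arccos (by linarith) (by linarith)]
    ring

theorem setIntegral_Ioo_div_pi_mul_sqrt (f : ℝ → ℝ) :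
    ∫ y in Set.Ioo (0 : ℝ) 4, f y / (π * √(y * (4 - y)))
      = π⁻¹ * ∫ θ in (0 : ℝ)..π, f (2 - 2 * cos θ) := by
  have hderiv (θ : ℝ) : HasDerivAt (fun θ : ℝ => 2 - 2 * cos θ) (2 * sin θ) θ := by
    simpa using ((hasDerivAt_cos θ).const_mul 2).const_sub 2
  have hinj : Set.InjOn (fun θ : ℝ => 2 - 2 * cos θ) (Set.Ioo 0 π) := by
    intro a ha b hb hab
    refine injOn_cos (Set.Ioo_subset_Icc_self ha) (Set.Ioo_subset_Icc_self hb) ?_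
    dsimp only at hab
    linarith
  rw [← image_two_sub_two_mul_cos_Ioo,
    integral_image_eq_integral_abs_deriv_smul measurableSet_Ioo
      (fun θ _ => (hderiv θ).hasDerivWithinAt) hinj,
    intervalIntegral.integral_of_le pi_pos.le, integral_Ioc_eq_integral_Ioo,
    ← integral_const_mul]
  refine setIntegral_congr_fun measurableSet_Ioo fun θ hθ => ?_
  have hsin : 0 < sin θ := sin_pos_of_mem_Ioo hθ
  have hsq : (2 - 2 * cos θ) * (4 - (2 - 2 * cos θ)) = (2 * sin θ) ^ 2 := by
    nlinarith [sin_sq_add_cos_sq θ]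
  simp only [smul_eq_mul, hsq]
  rw [sqrt_sq (by positivity), abs_of_pos (by positivity)]
  field_simp

theorem integral_comp_cos_zero_two_pi {f : ℝ → ℝ} (hf : Continuous fun θ => f (cos θ)) :
    ∫ θ in (0 : ℝ)..2 * π, f (cos θ) = 2 * ∫ θ in (0 : ℝ)..π, f (cos θ) := by
  have hrefl : ∫ θ in π..2 * π, f (cos θ) = ∫ θ in (0 : ℝ)..π, f (cos θ) := by
    have h := intervalIntegral.integral_comp_sub_left (a := 0) (b := π)
      (fun θ => f (cos θ)) (2 * π)
    simp only [cos_two_pi_sub, sub_zero] at h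
    rw [h]
    ring_nf
  rw [← intervalIntegral.integral_add_adjacent_intervals (hf.intervalIntegrable 0 π)
    (hf.intervalIntegrable π (2 * π)), hrefl, two_mul]

theorem norm_circleMap_sub_ofReal_sq (b θ : ℝ) :
    ‖circleMap 0 1 θ - b‖ ^ 2 = b ^ 2 + 1 - 2 * b * cos θ := by
  rw [← Complex.normSq_eq_norm_sq, Complex.normSq_apply]
  simp only [circleMap_zero, Complex.ofReal_one, one_mul, Complex.sub_re, Complex.sub_im,
    Complex.exp_ofReal_mul_I_re, Complex.exp_ofReal_mul_I_im, Complex.ofReal_re, Complex.ofReal_im]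
  nlinarith [sin_sq_add_cos_sq θ]

theorem integral_log_sub_two_mul_cos {b : ℝ} (hb : 1 < b) :
    ∫ θ in (0 : ℝ)..π, log (b + b⁻¹ - 2 * cos θ) = π * log b := by
  have hb0 : 0 < b := by linarith
  have hpos (θ : ℝ) : 0 < b + b⁻¹ - 2 * cos θ := by
    have : b + b⁻¹ - 2 = (b - 1) ^ 2 / b := by field_simp; ring
    have : 0 < (b - 1) ^ 2 / b := div_pos (pow_pos (by linarith) 2) hb0
    linarith [cos_le_one θ]
  have hcont : Continuous fun θ : ℝ => log (b + b⁻¹ - 2 * cos θ) :=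
    Continuous.log (by fun_prop) fun θ => (hpos θ).ne'
  have hlog (θ : ℝ) : log ‖circleMap 0 1 θ - b‖
      = 2⁻¹ * (log b + log (b + b⁻¹ - 2 * cos θ)) := by
    rw [← log_mul hb0.ne' (hpos θ).ne',
      show b * (b + b⁻¹ - 2 * cos θ) = ‖circleMap 0 1 θ - b‖ ^ 2 by
        rw [norm_circleMap_sub_ofReal_sq]; field_simp, log_pow]
    push_cast
    ring
  have havg := circleAverage_log_norm_sub_const₂ (a := (b : ℂ))
    (by rwa [Complex.norm_real, norm_of_nonneg hb0.le])
  rw [circleAverage_def, Complex.norm_real, norm_of_nonneg hb0.le] at havg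
  simp only [hlog, smul_eq_mul] at havg
  rw [intervalIntegral.integral_const_mul, intervalIntegral.integral_add
    (by simp) (hcont.intervalIntegrable _ _), intervalIntegral.integral_const,
    integral_comp_cos_zero_two_pi (f := fun c => log (b + b⁻¹ - 2 * c)) hcont] at havg
  simp only [smul_eq_mul, sub_zero] at havg
  generalize ∫ θ in (0 : ℝ)..π, log (b + b⁻¹ - 2 * cos θ) = J at havg ⊢
  field_simp at havg
  linarith

/-- Closed form of the regularized determinant of `x + Δ_ℤ` for `x > 0`:
`exp(∫_0^4 log(x+y)/(π√(y(4−y))) dy) = x/2 + 1 + (1/2)√(x(x+4))`. -/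
theorem regularized_det_Z (x : ℝ) (hx : 0 < x) :
    Real.exp (∫ y in Set.Ioo (0 : ℝ) 4, Real.log (x + y) / (π * Real.sqrt (y * (4 - y))))
      = x / 2 + 1 + (1 / 2) * Real.sqrt (x * (x + 4)) := by
  set b := x / 2 + 1 + (1 / 2) * Real.sqrt (x * (x + 4)) with hbdef
  have hsq : √(x * (x + 4)) ^ 2 = x * (x + 4) := sq_sqrt (by positivity)
  have hb : 1 < b := by
    have := sqrt_nonneg (x * (x + 4))
    linarith
  have hb0 : 0 < b := by linarith
  have hsum : b + b⁻¹ = x + 2 := by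
    field_simp
    rw [hbdef]
    linarith
  rw [setIntegral_Ioo_div_pi_mul_sqrt fun y => log (x + y)]
  simp only [← add_sub_assoc, ← hsum]
  rw [integral_log_sub_two_mul_cos hb, inv_mul_cancel_left₀ pi_ne_zero, exp_log hb0]
end

section
/- For every real number x > 4, one has x/2 + 1 + (1/2)·√(x(x+4)) = x + 2 + ∑_{n=1}^∞ (−1)^n · C_n / x^n, where C_n = C(2n,n)/(n+1) is the n-th Catalan number and the series on the right converges. (Thus the regularized determinant det*(x+Δ_ℤ) has the Catalan numbers, with alternating signs, as the coefficients of its expansion in powers of 1/x.) -/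
theorem catalan_succ_le_four_mul (n : ℕ) : catalan (n + 1) ≤ 4 * catalan n := by
  have h₁ := succ_mul_catalan_eq_centralBinom n
  have h₂ := succ_mul_catalan_eq_centralBinom (n + 1)
  have h₃ := Nat.succ_mul_centralBinom_succ n
  rw [← h₁, ← h₂] at h₃
  have h₄ : (n + 2) * catalan (n + 1) = 2 * (2 * n + 1) * catalan n :=
    Nat.eq_of_mul_eq_mul_left n.succ_pos (by linarith)
  refine le_of_mul_le_mul_left (a := n + 2) ?_ (Nat.succ_pos _)
  nlinarith [Nat.zero_le (catalan n)]

theorem catalan_le_four_pow (n : ℕ) : catalan n ≤ 4 ^ n := by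
  induction n with
  | zero => simp
  | succ k ih => exact (catalan_succ_le_four_mul k).trans (by rw [pow_succ']; gcongr)

theorem summable_norm_catalan_mul_pow {y : ℝ} (hy : |y| < 1 / 4) :
    Summable fun n : ℕ => ‖(catalan n : ℝ) * y ^ n‖ := by
  refine Summable.of_nonneg_of_le (fun n => norm_nonneg _) (fun n => ?_)
    (summable_geometric_of_lt_one (r := 4 * |y|) (by positivity) (by linarith))
  rw [norm_mul, norm_pow, Real.norm_eq_abs, Real.norm_eq_abs, Nat.abs_cast, mul_pow]
  gcongr
  exact_mod_cast catalan_le_four_pow n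

theorem tsum_catalan_mul_pow_eq {y : ℝ} (hy : |y| < 1 / 4) :
    ∑' n : ℕ, (catalan n : ℝ) * y ^ n = 1 + y * (∑' n : ℕ, (catalan n : ℝ) * y ^ n) ^ 2 := by
  have hs := summable_norm_catalan_mul_pow hy
  rw [sq, tsum_mul_tsum_eq_tsum_sum_antidiagonal_of_summable_norm hs hs, ← tsum_mul_left,
    hs.of_norm.tsum_eq_zero_add]
  congr 1
  · simp
  · refine tsum_congr fun n => ?_
    rw [catalan_succ', Nat.cast_sum, Finset.sum_mul, Finset.mul_sum]
    refine Finset.sum_congr rfl fun p hp => ?_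
    rw [← Finset.HasAntidiagonal.mem_antidiagonal.mp hp]
    push_cast
    ring

theorem tsum_catalan_mul_pow_nonneg_of_nonpos {y : ℝ} (hy : |y| < 1 / 4) (hy₀ : y ≤ 0) :
    0 ≤ ∑' n : ℕ, (catalan n : ℝ) * y ^ n := by
  have hs := (summable_norm_catalan_mul_pow hy).of_norm
  have he : Summable fun k : ℕ => (catalan (2 * k) : ℝ) * y ^ (2 * k) :=
    hs.comp_injective (i := fun k => 2 * k) fun a b h => by simpa using h
  have ho : Summable fun k : ℕ => (catalan (2 * k + 1) : ℝ) * y ^ (2 * k + 1) :=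
    hs.comp_injective (i := fun k => 2 * k + 1) fun a b h => by simpa using h
  rw [← tsum_even_add_odd (f := fun n : ℕ => (catalan n : ℝ) * y ^ n) he ho, ← he.tsum_add ho]
  refine tsum_nonneg fun k => ?_
  have hc : (catalan (2 * k + 1) : ℝ) ≤ 4 * catalan (2 * k) := by
    exact_mod_cast catalan_succ_le_four_mul (2 * k)
  have hp : 0 ≤ y ^ (2 * k) := (even_two_mul k).pow_nonneg y
  have hn : 0 ≤ (catalan (2 * k) : ℝ) := Nat.cast_nonneg _
  have h : 0 ≤ (catalan (2 * k) : ℝ) + catalan (2 * k + 1) * y := by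
    rw [abs_of_nonpos hy₀] at hy
    nlinarith
  calc (0 : ℝ) ≤ ((catalan (2 * k) : ℝ) + catalan (2 * k + 1) * y) * y ^ (2 * k) := by positivity
    _ = _ := by ring

/-- For `x > 4`, the regularized determinant `det*(x+Δ_ℤ) = x/2 + 1 + (1/2)√(x(x+4))`
expands as `x + 2 + ∑_{n≥1} (−1)^n C_n / x^n`, where `C_n` is the `n`-th Catalan number;
the series converges. -/
theorem regularized_det_Z_catalan_expansion (x : ℝ) (hx : 4 < x) :
    HasSum (fun n : ℕ => (-1 : ℝ) ^ (n + 1) * (catalan (n + 1) : ℝ) / x ^ (n + 1))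
      (x / 2 + 1 + (1 / 2) * Real.sqrt (x * (x + 4)) - (x + 2)) := by
  have hx₀ : 0 < x := by linarith
  have hy : |-x⁻¹| < 1 / 4 := by
    rw [abs_neg, abs_of_pos (inv_pos.mpr hx₀), one_div]
    exact inv_strictAnti₀ (by norm_num) hx
  have heq := tsum_catalan_mul_pow_eq hy
  have hnn := tsum_catalan_mul_pow_nonneg_of_nonpos hy (by simpa using hx₀.le)
  have hsum := (summable_norm_catalan_mul_pow hy).of_norm.hasSum
  set S := ∑' n : ℕ, (catalan n : ℝ) * (-x⁻¹) ^ n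
  have hquad : x * S = x - S ^ 2 := by
    calc x * S = x * (1 + -x⁻¹ * S ^ 2) := by rw [← heq]
      _ = x - S ^ 2 := by field_simp; ring
  have hsqrt : Real.sqrt (x * (x + 4)) = 2 * S + x := by
    rw [Real.sqrt_eq_iff_mul_self_eq (by positivity) (by positivity)]
    nlinarith
  rw [hsqrt]
  have hterm (n : ℕ) : (-1 : ℝ) ^ (n + 1) * (catalan (n + 1) : ℝ) / x ^ (n + 1) =
      (catalan (n + 1) : ℝ) * (-x⁻¹) ^ (n + 1) := by
    rw [neg_pow x⁻¹, inv_pow]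
    ring
  have hval : x / 2 + 1 + 1 / 2 * (2 * S + x) - (x + 2) =
      S - ∑ i ∈ Finset.range 1, (catalan i : ℝ) * (-x⁻¹) ^ i := by
    rw [Finset.sum_range_one, catalan_zero]
    push_cast
    ring
  simp only [hterm, hval]
  exact (hasSum_nat_add_iff' 1).mpr hsum
end

section
/- Let μ be a Borel probability measure on ℝ supported in the interval [0,R] for some R > 0. Then for every real x > R, exp( ∫ log(x+y) μ(dy) ) = x · exp( ∑_{k=1}^∞ ((−1)^{k+1} / (k·x^k)) · ∫ y^k μ(dy) ), and the series on the right converges. (For a rooted graph (G,v) with Laplacian Δ of norm at most R and spectral measure μ = μ^{δ_v,δ_v}, this expresses the regularized determinant det*(x+Δ) in terms of the special values ζ_G(−k) = ∫ y^k μ(dy) of the spectral zeta function.) -/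
/-- The Mercator expansion of `log (1 + y / x)` for `|y| < x`. -/
theorem hasSum_log_one_add_div {x y : ℝ} (h : |y| < x) :
    HasSum (fun j : ℕ => (-1 : ℝ) ^ j / ((j + 1) * x ^ (j + 1)) * y ^ (j + 1))
      (Real.log (1 + y / x)) := by
  have hx : 0 < x := (abs_nonneg y).trans_lt h
  have hlt : |-(y / x)| < 1 := by
    rwa [abs_neg, abs_div, abs_of_pos hx, div_lt_one hx]
  have hsum := (Real.hasSum_pow_div_log_of_abs_lt_one hlt).neg
  rw [neg_neg, sub_neg_eq_add] at hsum
  refine hsum.congr_fun fun j => ?_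
  rw [neg_pow (y / x), div_pow, pow_succ (-1 : ℝ)]
  field_simp

open MeasureTheory

/-- For a Borel probability measure `μ` supported in `[0,R]` and `x > R`, the regularized
determinant `exp(∫ log(x+y) μ(dy))` equals `x · exp(∑_{k≥1} ((−1)^{k+1}/(k·x^k)) ∫ y^k μ(dy))`,
and the series converges.  (Here the series is indexed by `j = k − 1`.) -/
theorem regularized_det_eq_exp_zeta_series (R : ℝ) (hR : 0 < R)
    (μ : Measure ℝ) [IsProbabilityMeasure μ] (hsupp : μ (Set.Icc 0 R)ᶜ = 0)
    (x : ℝ) (hx : R < x) :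
    ∃ S : ℝ,
      HasSum (fun j : ℕ =>
        ((-1 : ℝ) ^ j / ((j + 1) * x ^ (j + 1))) * ∫ y, y ^ (j + 1) ∂μ) S ∧
      Real.exp (∫ y, Real.log (x + y) ∂μ) = x * Real.exp S := by
  have hx0 : 0 < x := hR.trans hx
  have hmem : ∀ᵐ y ∂μ, y ∈ Set.Icc 0 R := mem_ae_iff.mpr hsupp
  have hr : R / x < 1 := (div_lt_one hx0).mpr hx
  have hr0 : 0 ≤ R / x := by positivity
  refine ⟨∫ y, Real.log (1 + y / x) ∂μ, ?_, ?_⟩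
  · simp_rw [← integral_const_mul]
    refine hasSum_integral_of_dominated_convergence (fun j _ => (R / x) ^ (j + 1))
      (fun j => by fun_prop) (fun j => ?_) ?_ (integrable_const _) ?_
    · filter_upwards [hmem] with y hy
      rw [norm_mul, norm_div, norm_pow, norm_neg, norm_one, one_pow, Real.norm_of_nonneg
        (by positivity), Real.norm_of_nonneg (pow_nonneg hy.1 _), div_pow, div_mul_eq_mul_div,
        one_mul]
      have hj : (1 : ℝ) ≤ j + 1 := by simp
      have hpow : x ^ (j + 1) ≤ (j + 1) * x ^ (j + 1) :=
        le_mul_of_one_le_left (by positivity) hj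
      gcongr
      exacts [hy.1, hy.2]
    · filter_upwards with y
      exact (summable_nat_add_iff 1).mpr (summable_geometric_of_lt_one hr0 hr)
    · filter_upwards [hmem] with y hy
      exact hasSum_log_one_add_div (by rw [abs_of_nonneg hy.1]; exact hy.2.trans_lt hx)
  · have hint : Integrable (fun y => Real.log (1 + y / x)) μ := by
      refine Integrable.of_bound (Measurable.aestronglyMeasurable (by fun_prop)) (Real.log (1 + R / x)) ?_
      filter_upwards [hmem] with y hy
      have hy0 : 0 ≤ y / x := div_nonneg hy.1 hx0.le
      rw [Real.norm_of_nonneg (Real.log_nonneg (by linarith))]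
      have := hy.2
      gcongr
    have hlog : ∫ y, Real.log (x + y) ∂μ = Real.log x + ∫ y, Real.log (1 + y / x) ∂μ := by
      rw [integral_congr_ae (g := fun y => Real.log x + Real.log (1 + y / x)) ?_,
        integral_add (integrable_const _) hint]
      · simp
      · filter_upwards [hmem] with y hy
        have hy0 : 0 ≤ y / x := div_nonneg hy.1 hx0.le
        rw [← Real.log_mul hx0.ne' (by positivity)]
        congr 1
        field_simp
    rw [hlog, Real.exp_add, Real.exp_log hx0]
end

section
/- Let n ≥ 3 be a natural number and let L be the Laplacian matrix of the cycle graph on n vertices (the n×n matrix with diagonal entries 2, entries −1 between cyclically adjacent vertices, and 0 elsewhere). Then for every real number x, det(x·I + L) = ∑_{l=0}^{n−1} C(2n−l, l) · (2n/(2n−l)) · x^{n−l}, where C(2n−l,l) is a binomial coefficient and each coefficient C(2n−l,l)·2n/(2n−l) is a positive integer. -/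
open Finset Matrix

/-- The determinant of a circulant matrix over a finite commutative ring `A` is the product of the
values of the Fourier transform of its first column, taken with respect to a primitive character. -/
theorem Matrix.det_circulant_eq_prod_addChar {A K : Type*} [CommRing A] [Fintype A]
    [DecidableEq A] [Field K] {ψ : AddChar A K} (hψ : ψ.IsPrimitive)
    (hA : (Fintype.card A : K) ≠ 0) (v : A → K) :
    (circulant v).det = ∏ k, ∑ m, v m * ψ (-(m * k)) := by
  set V : Matrix A A K := of fun i k ↦ ψ (i * k)
  have hV : V * of (fun k i ↦ ψ (-(k * i))) = (Fintype.card A : K) • 1 := by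
    ext i j
    have h := AddChar.sum_mulShift (i - j) hψ
    simp only [mul_apply, V, of_apply, ← AddChar.map_add_eq_mul, smul_apply, one_apply,
      smul_eq_mul, mul_ite, mul_one, mul_zero]
    simp only [sub_eq_zero] at h
    push_cast at h
    rw [← h]
    exact sum_congr rfl fun k _ ↦ by ring_nf
  have hdet : V.det ≠ 0 := by
    intro h
    have := congrArg det hV
    rw [det_mul, h, zero_mul, det_smul, det_one, mul_one] at this
    exact pow_ne_zero _ hA this.symm
  have hmul : circulant v * V = V * diagonal fun k ↦ ∑ m, v m * ψ (-(m * k)) := by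
    ext i k
    rw [mul_diagonal, mul_sum, mul_apply, ← Equiv.sum_comp (Equiv.subLeft i)]
    refine sum_congr rfl fun m _ ↦ ?_
    simp only [circulant_apply, Equiv.subLeft_apply, sub_sub_cancel, V, of_apply]
    rw [mul_left_comm, ← AddChar.map_add_eq_mul]
    ring_nf
  have := congrArg det hmul
  rw [det_mul, det_mul, det_diagonal, mul_comm] at this
  exact mul_left_cancel₀ hdet this

theorem ZMod.prod_sub_stdAddChar (n : ℕ) [NeZero n] (a : ℂ) :
    ∏ k : ZMod n, (a - ZMod.stdAddChar k) = a ^ n - 1 := by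
  classical
  have hζ := Complex.isPrimitiveRoot_exp n (NeZero.ne n)
  have hinj := ZMod.injective_stdAddChar (N := n)
  have himage : univ.image (ZMod.stdAddChar (N := n)) = Polynomial.nthRootsFinset n (1 : ℂ) := by
    refine eq_of_subset_of_card_le (fun z hz ↦ ?_) ?_
    · obtain ⟨k, -, rfl⟩ := mem_image.mp hz
      rw [Polynomial.mem_nthRootsFinset (NeZero.pos n), ← AddChar.map_nsmul_eq_pow]
      simp
    · rw [hζ.card_nthRootsFinset, card_image_of_injective _ hinj, card_univ, ZMod.card]
  have h := hζ.pow_sub_pow_eq_prod_sub_mul a 1 (NeZero.pos n)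
  rw [one_pow, ← himage, prod_image hinj.injOn] at h
  simpa using h.symm

/-- The determinant of `y • 1 - P - P⁻¹`, where `P` is the matrix of the shift on `ZMod n` and
`y = a + a⁻¹`. -/
theorem det_circulant_cycle (n : ℕ) [NeZero n] {a : ℂ} (ha : a ≠ 0) :
    (circulant (Pi.single (0 : ZMod n) (a + a⁻¹) - Pi.single 1 1 - Pi.single (-1) 1)).det =
      a ^ n + a⁻¹ ^ n - 2 := by
  rw [det_circulant_eq_prod_addChar (ZMod.isPrimitive_stdAddChar n) (by simp [NeZero.ne n])]
  have hfactor (k : ZMod n) : ∑ m, (Pi.single (0 : ZMod n) (a + a⁻¹) - Pi.single 1 1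
        - Pi.single (-1) 1 : ZMod n → ℂ) m * ZMod.stdAddChar (-(m * k)) =
      (a - ZMod.stdAddChar k) * (a - ZMod.stdAddChar (-k)) * a⁻¹ := by
    have h : ZMod.stdAddChar k * ZMod.stdAddChar (-k) = (1 : ℂ) := by
      rw [← AddChar.map_add_eq_mul, add_neg_cancel, AddChar.map_zero_eq_one]
    simp only [Pi.sub_apply, Pi.single_apply, sub_mul, ite_mul, zero_mul, sum_sub_distrib,
      sum_ite_eq', mem_univ, if_true, neg_mul, one_mul, neg_neg, neg_zero,
      AddChar.map_zero_eq_one, mul_one]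
    field_simp
    linear_combination -h
  have hneg : ∏ k : ZMod n, (a - ZMod.stdAddChar (-k)) = ∏ k : ZMod n, (a - ZMod.stdAddChar k) :=
    Equiv.prod_comp (Equiv.neg (ZMod n)) fun k ↦ a - ZMod.stdAddChar k
  rw [prod_congr rfl fun k _ ↦ hfactor k, prod_mul_distrib, prod_mul_distrib,
    hneg, ZMod.prod_sub_stdAddChar, prod_const, card_univ, ZMod.card, inv_pow]
  field_simp
  ring

/-- The explicit expansion of `a ^ n + b ^ n`, for `a * b = 1`, in powers of `a + b - 2`. -/
theorem sum_choose_mul_pow_eq_pow_add_pow {R : Type*} [CommRing R] {a b : R} (hab : a * b = 1)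
    (n : ℕ) : ∑ k ∈ range (n + 1), (((n + k).choose (2 * k) + (n + k - 1).choose (2 * k) : ℕ) : R) *
      (a + b - 2) ^ k = a ^ n + b ^ n := by
  set d : ℕ → ℕ → ℕ := fun n k ↦ (n + k).choose (2 * k) + (n + k - 1).choose (2 * k) with hd
  have hd0 (n : ℕ) : d n 0 = 2 := by simp [d]
  have hdlt {n k : ℕ} (h : n < k) : d n k = 0 := by
    simp only [hd]
    rw [Nat.choose_eq_zero_of_lt (by omega), Nat.choose_eq_zero_of_lt (by omega)]
  have hchoose (m j : ℕ) : (m + 2).choose (j + 2) + m.choose (j + 2) =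
      2 * (m + 1).choose (j + 2) + m.choose j := by
    simp only [Nat.choose_succ_succ']
    ring
  have hrec (n k : ℕ) : d (n + 2) (k + 1) + d n (k + 1) = 2 * d (n + 1) (k + 1) + d (n + 1) k := by
    have h₁ := hchoose (n + k + 1) (2 * k)
    have h₂ := hchoose (n + k) (2 * k)
    simp only [hd, show n + 2 + (k + 1) = n + k + 1 + 2 by ring,
      show n + (k + 1) = n + k + 1 by ring, show n + 1 + (k + 1) = n + k + 1 + 1 by ring,
      show n + 1 + k = n + k + 1 by ring,
      show 2 * (k + 1) = 2 * k + 2 by ring, Nat.add_sub_cancel,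
      show n + k + 1 + 2 - 1 = n + k + 2 by omega]
    omega
  set x := a + b - 2 with hx
  have hext {n N : ℕ} (h : n + 1 ≤ N) :
      ∑ k ∈ range (n + 1), (d n k : R) * x ^ k = ∑ k ∈ range N, (d n k : R) * x ^ k := by
    refine sum_subset (range_subset_range.mpr h) fun k _ hk ↦ ?_
    rw [hdlt (by simpa [Nat.succ_le_iff] using hk), Nat.cast_zero, zero_mul]
  induction n using Nat.twoStepInduction with
  | zero => simp [one_add_one_eq_two]
  | one => simp [sum_range_succ, hx]; ring
  | more n ih₀ ih₁ =>
    have key : ∑ k ∈ range (n + 3), (d (n + 2) k : R) * x ^ k +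
        ∑ k ∈ range (n + 3), (d n k : R) * x ^ k =
        2 * ∑ k ∈ range (n + 3), (d (n + 1) k : R) * x ^ k +
        x * ∑ k ∈ range (n + 2), (d (n + 1) k : R) * x ^ k := by
      simp only [sum_range_succ' _ (n + 2), hd0, mul_add, mul_sum]
      rw [add_add_add_comm, ← sum_add_distrib, add_right_comm, ← sum_add_distrib]
      congr 1
      · refine sum_congr rfl fun k _ ↦ ?_
        have h := congrArg (Nat.cast (R := R)) (hrec n k)
        push_cast at h
        linear_combination x ^ (k + 1) * h
      · push_cast; ring
    rw [← hext (by omega : n + 1 ≤ n + 3), ← hext (by omega : n + 1 + 1 ≤ n + 3), ih₀] at key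
    rw [show n + 2 = n + 1 + 1 from rfl, ih₁] at key
    linear_combination key + (a ^ n + b ^ n) * hab + (a ^ (n + 1) + b ^ (n + 1)) * hx

theorem choose_add_choose_eq_choose_mul_div {K : Type*} [Field K] [CharZero K] {n l : ℕ}
    (h : l < n) :
    (((n + (n - l)).choose (2 * (n - l)) + (n + (n - l) - 1).choose (2 * (n - l)) : ℕ) : K) =
      ((2 * n - l).choose l : K) * ((2 * n : K) / ((2 * n - l : ℕ) : K)) := by
  obtain ⟨k, rfl⟩ := Nat.exists_eq_add_of_lt h
  have h₁ : l + k + 1 - l = k + 1 := by omega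
  have h₂ : 2 * (l + k + 1) - l = l + 2 * k + 1 + 1 := by omega
  have h₃ : l + k + 1 + (k + 1) = l + 2 * k + 1 + 1 := by omega
  have hsymm : (l + 2 * k + 1 + 1).choose l = (l + 2 * k + 1 + 1).choose (2 * (k + 1)) :=
    Nat.choose_symm_of_eq_add (by ring)
  have hmul := Nat.choose_mul_succ_eq (l + 2 * k + 1) (2 * (k + 1))
  rw [show l + 2 * k + 1 + 1 - 2 * (k + 1) = l by omega] at hmul
  rw [h₁, h₂, h₃, Nat.add_sub_cancel, hsymm, mul_div_assoc',
    eq_div_iff (Nat.cast_ne_zero.mpr (by omega))]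
  have hcast := congrArg (Nat.cast (R := K)) hmul
  push_cast at hcast ⊢
  linear_combination hcast

/-- The characteristic polynomial of the Laplacian of the cycle graph on `n ≥ 3` vertices:
`det(x·I + L) = ∑_{l=0}^{n−1} C(2n−l,l)·(2n/(2n−l))·x^{n−l}`, and each coefficient
`C(2n−l,l)·2n/(2n−l)` is a positive integer. -/
theorem cycle_lapMatrix_charpoly (n : ℕ) [NeZero n] (hn : 3 ≤ n)
    (L : Matrix (ZMod n) (ZMod n) ℝ)
    (hL : ∀ i j : ZMod n, L i j =
      if i = j then 2 else if j = i + 1 ∨ j = i - 1 then -1 else 0)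
    (x : ℝ) :
    (x • (1 : Matrix (ZMod n) (ZMod n) ℝ) + L).det
        = ∑ l ∈ Finset.range n,
            ((2 * n - l).choose l : ℝ) * ((2 * n : ℝ) / ((2 * n - l : ℕ) : ℝ)) * x ^ (n - l)
      ∧ ∀ l ∈ Finset.range n, ∃ m : ℕ, 0 < m ∧
          (m : ℝ) = ((2 * n - l).choose l : ℝ) * ((2 * n : ℝ) / ((2 * n - l : ℕ) : ℝ)) := by
  have hcoeff {l : ℕ} (hl : l ∈ range n) :=
    choose_add_choose_eq_choose_mul_div (K := ℝ) (mem_range.mp hl)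
  refine ⟨?_, fun l hl ↦ ⟨_, Nat.add_pos_left (Nat.choose_pos ?_) _, hcoeff hl⟩⟩
  swap
  · omega
  obtain ⟨a, ha, hax⟩ : ∃ a : ℂ, a ≠ 0 ∧ a + a⁻¹ = x + 2 := by
    obtain ⟨s, hs⟩ := IsAlgClosed.exists_eq_mul_self (discrim 1 (-(x + 2 : ℂ)) 1)
    obtain ⟨a, ha⟩ := exists_quadratic_eq_zero one_ne_zero ⟨s, hs⟩
    have ha0 : a ≠ 0 := by rintro rfl; simp at ha
    refine ⟨a, ha0, ?_⟩
    field_simp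
    linear_combination ha
  have : Fact (1 < n) := ⟨by omega⟩
  have : Fact (2 < n) := ⟨by omega⟩
  have hmap : Complex.ofRealHom.mapMatrix (x • 1 + L) =
      circulant (Pi.single (0 : ZMod n) (a + a⁻¹) - Pi.single 1 1 - Pi.single (-1) 1) := by
    have h₁ : (-1 : ZMod n) ≠ 1 := ZMod.neg_one_ne_one
    ext i j
    obtain ⟨m, rfl⟩ : ∃ m, i = j + m := ⟨i - j, by ring⟩
    have e₁ : j = j + m + 1 ↔ m = -1 := by
      rw [add_assoc, left_eq_add, eq_neg_iff_add_eq_zero]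
    have e₂ : j = j + m - 1 ↔ m = 1 := by
      rw [add_sub_assoc, left_eq_add, sub_eq_zero]
    simp only [RingHom.mapMatrix_apply, map_apply, Matrix.add_apply, Matrix.smul_apply,
      one_apply, hL, hax, circulant_apply, add_sub_cancel_left, Pi.sub_apply, Pi.single_apply,
      e₁, e₂, add_eq_left]
    by_cases m0 : m = 0
    · simp [m0]
    by_cases m1 : m = 1
    · simp [m1, h₁.symm]
    by_cases m2 : m = -1 <;> simp [m0, m1, m2, h₁]
  apply Complex.ofRealHom.injective
  rw [RingHom.map_det, hmap, det_circulant_cycle n ha,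
    ← sum_choose_mul_pow_eq_pow_add_pow (mul_inv_cancel₀ ha), ← sum_range_reflect, sum_range_succ,
    map_sum, add_sub_assoc]
  simp only [hax, add_sub_cancel_right]
  norm_num
  refine sum_congr rfl fun l hl ↦ ?_
  rw [← Nat.cast_add]
  have h := congrArg Complex.ofReal (hcoeff hl)
  push_cast at h ⊢
  rw [h]
end

section
/- For every natural number n ≥ 3 and every real number x, ∏_{k=0}^{n−1} ( x + 4·sin²(kπ/n) ) = ∑_{l=0}^{n−1} C(2n−l, l) · (2n/(2n−l)) · x^{n−l}. (The left-hand side is the characteristic polynomial det(x·I + L) of the Laplacian of the cycle graph on n vertices, written as a product over its eigenvalues 4sin²(kπ/n), and the right-hand side gives its integer coefficients.) -/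
open Real

open Finset in
theorem sum_choose_two_mul_add_two {R : Type*} [CommRing R] (x : R) (n : ℕ) :
    ∑ j ∈ range (n + 3), ((n + 2 + j).choose (2 * j) : R) * x ^ j
      = (x + 2) * ∑ j ∈ range (n + 2), ((n + 1 + j).choose (2 * j) : R) * x ^ j
        - ∑ j ∈ range (n + 1), ((n + j).choose (2 * j) : R) * x ^ j := by
  have extend (m k : ℕ) : ∑ j ∈ range (m + 1), ((m + j).choose (2 * j) : R) * x ^ j
      = ∑ j ∈ range (m + 1 + k), ((m + j).choose (2 * j) : R) * x ^ j := by
    rw [sum_range_add _ (m + 1) k, left_eq_add]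
    refine sum_eq_zero fun i _ ↦ ?_
    rw [Nat.choose_eq_zero_of_lt (by lia), Nat.cast_zero, zero_mul]
  have hx : x * ∑ j ∈ range (n + 2), ((n + 1 + j).choose (2 * j) : R) * x ^ j
      = ∑ j ∈ range (n + 2), ((n + 1 + j).choose (2 * j) : R) * x ^ (j + 1) := by
    rw [mul_sum]
    exact sum_congr rfl fun j _ ↦ by ring
  rw [add_mul, hx, extend (n + 1) 1, extend n 2, sum_range_succ', sum_range_succ' _ (n + 2),
    sum_range_succ' _ (n + 2), mul_add, mul_sum]
  have key : ∑ j ∈ range (n + 2), ((n + 2 + (j + 1)).choose (2 * (j + 1)) : R) * x ^ (j + 1)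
      = ∑ j ∈ range (n + 2), ((n + 1 + j).choose (2 * j) : R) * x ^ (j + 1)
        + ∑ j ∈ range (n + 2), 2 * (((n + 1 + (j + 1)).choose (2 * (j + 1)) : R) * x ^ (j + 1))
        - ∑ j ∈ range (n + 2), ((n + (j + 1)).choose (2 * (j + 1)) : R) * x ^ (j + 1) := by
    rw [← sum_add_distrib, ← sum_sub_distrib]
    refine sum_congr rfl fun j _ ↦ ?_
    rw [show n + 2 + (j + 1) = n + 1 + j + 1 + 1 by lia,
      show n + 1 + (j + 1) = n + 1 + j + 1 by lia, show n + (j + 1) = n + 1 + j by lia,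
      show 2 * (j + 1) = 2 * j + 1 + 1 by lia, Nat.choose_succ_succ' (n + 1 + j + 1),
      Nat.choose_succ_succ' (n + 1 + j) (2 * j), Nat.choose_succ_succ' (n + 1 + j) (2 * j + 1)]
    push_cast
    ring
  rw [key]
  simp
  ring

open Finset in
theorem sum_choose_two_mul_add_sum {R : Type*} [CommRing R] {x y z : R} (hyz : y * z = 1)
    (hx : x = y + z - 2) (n : ℕ) :
    ∑ j ∈ range (n + 2), ((n + 1 + j).choose (2 * j) : R) * x ^ j
      + ∑ j ∈ range (n + 1), ((n + j).choose (2 * j) : R) * x ^ j = y ^ (n + 1) + z ^ (n + 1) := by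
  induction n using Nat.twoStepInduction with
  | zero =>
    simp [sum_range_succ, hx]
    ring
  | one =>
    have h := sum_choose_two_mul_add_two x 0
    simp [sum_range_succ, Nat.choose, hx] at h ⊢
    linear_combination 2 * hyz
  | more n h₀ h₁ =>
    rw [sum_choose_two_mul_add_two x (n + 1), sum_choose_two_mul_add_two x n] at *
    subst hx
    linear_combination (y + z) * h₁ - h₀ + (y ^ (n + 1) + z ^ (n + 1)) * hyz

theorem choose_mul_two_mul_div {n j : ℕ} (hj : j < n) :
    ((n + 1 + j).choose (n - 1 - j) : ℝ) * (2 * n / (n + 1 + j : ℕ))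
      = ((n + (j + 1)).choose (2 * (j + 1)) : ℝ) + ((n - 1 + (j + 1)).choose (2 * (j + 1)) : ℝ) := by
  obtain ⟨k, rfl⟩ := Nat.exists_eq_add_of_lt hj
  rw [show j + k + 1 + 1 + j = k + (2 * j + 1 + 1) by lia, show j + k + 1 - 1 - j = k by lia,
    Nat.choose_symm_add, show j + k + 1 + (j + 1) = k + 2 * j + 1 + 1 by lia,
    show j + k + 1 - 1 + (j + 1) = k + 2 * j + 1 by lia, show 2 * (j + 1) = 2 * j + 1 + 1 by lia,
    show k + (2 * j + 1 + 1) = k + 2 * j + 1 + 1 by lia]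
  have h := Nat.choose_mul_succ_eq (k + 2 * j + 1) (2 * j + 1 + 1)
  rw [show k + 2 * j + 1 + 1 - (2 * j + 1 + 1) = k by lia] at h
  have h' : ((k + 2 * j + 1).choose (2 * j + 1 + 1) : ℝ) * (k + 2 * j + 1 + 1)
      = (k + 2 * j + 1 + 1).choose (2 * j + 1 + 1) * k := mod_cast h
  push_cast
  field_simp
  linear_combination -h'

open Finset in
theorem IsPrimitiveRoot.prod_range_sub_pow {R : Type*} [CommRing R] [IsDomain R] {ζ : R} {n : ℕ}
    (h : IsPrimitiveRoot ζ n) (hn : 0 < n) (y : R) :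
    ∏ k ∈ range n, (y - ζ ^ k) = y ^ n - 1 := by
  have h₁ := congrArg (Polynomial.eval y) (X_pow_sub_C_eq_prod h hn (one_pow n))
  simpa [Polynomial.eval_prod] using h₁.symm

theorem exists_mul_eq_one_and_add_eq (t : ℂ) : ∃ y z : ℂ, y * z = 1 ∧ y + z = t := by
  obtain ⟨s, hs⟩ := IsAlgClosed.exists_eq_mul_self (t ^ 2 - 4)
  refine ⟨(t + s) / 2, (t - s) / 2, ?_, ?_⟩
  · linear_combination hs / 4
  · ring

theorem four_mul_sin_sq_eq (n k : ℕ) :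
    (4 * Real.sin (k * π / n) ^ 2 : ℂ)
      = 2 - Complex.exp (2 * π * Complex.I / n) ^ k - (Complex.exp (2 * π * Complex.I / n))⁻¹ ^ k := by
  rw [← Complex.exp_neg, ← Complex.exp_nat_mul, ← Complex.exp_nat_mul, Complex.ofReal_sin,
    Complex.sin_sq, Complex.cos_sq, Complex.cos]
  push_cast
  ring_nf

open Finset in
theorem prod_add_four_mul_sin_sq {n : ℕ} (hn : n ≠ 0) {x y z : ℂ} (hyz : y * z = 1)
    (hx : x = y + z - 2) :
    ∏ k ∈ range n, (x + 4 * (Real.sin (k * π / n) : ℂ) ^ 2) = y ^ n + z ^ n - 2 := by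
  have hζ := Complex.isPrimitiveRoot_exp n hn
  have hfac (k : ℕ) : x + 4 * (Real.sin (k * π / n) : ℂ) ^ 2
      = z * ((y - Complex.exp (2 * π * Complex.I / n) ^ k)
        * (y - (Complex.exp (2 * π * Complex.I / n))⁻¹ ^ k)) := by
    have hinv : Complex.exp (2 * π * Complex.I / n) ^ k
        * (Complex.exp (2 * π * Complex.I / n))⁻¹ ^ k = 1 := by
      rw [← mul_pow, mul_inv_cancel₀ (Complex.exp_ne_zero _), one_pow]
    rw [four_mul_sin_sq_eq, hx]
    linear_combination (Complex.exp (2 * π * Complex.I / n) ^ k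
      + (Complex.exp (2 * π * Complex.I / n))⁻¹ ^ k - y) * hyz - z * hinv
  have hpow : y ^ n * z ^ n = 1 := by rw [← mul_pow, hyz, one_pow]
  simp only [hfac, prod_mul_distrib, hζ.prod_range_sub_pow hn.bot_lt,
    hζ.inv.prod_range_sub_pow hn.bot_lt, prod_const, card_range]
  linear_combination (y ^ n - 2) * hpow

/-- The characteristic polynomial of the Laplacian of the cycle graph on `n ≥ 3` vertices,
as a product over the eigenvalues `4sin²(kπ/n)`, equals the polynomial with coefficients
`C(2n−l,l)·2n/(2n−l)`. -/
theorem cycle_charpoly_product_formula (n : ℕ) (hn : 3 ≤ n) (x : ℝ) :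
    ∏ k ∈ Finset.range n, (x + 4 * Real.sin (k * π / n) ^ 2)
      = ∑ l ∈ Finset.range n,
          ((2 * n - l).choose l : ℝ) * ((2 * n : ℝ) / ((2 * n - l : ℕ) : ℝ)) * x ^ (n - l) := by
  obtain ⟨y, z, hyz, hadd⟩ := exists_mul_eq_one_and_add_eq (x + 2)
  have hx : (x : ℂ) = y + z - 2 := by rw [hadd]; ring
  have hsum : ∑ l ∈ Finset.range n,
        ((2 * n - l).choose l : ℝ) * ((2 * n : ℝ) / ((2 * n - l : ℕ) : ℝ)) * x ^ (n - l)
      = ∑ j ∈ Finset.range n, (((n + (j + 1)).choose (2 * (j + 1)) : ℝ) * x ^ (j + 1)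
        + ((n - 1 + (j + 1)).choose (2 * (j + 1)) : ℝ) * x ^ (j + 1)) := by
    rw [← Finset.sum_range_reflect]
    refine Finset.sum_congr rfl fun j hj ↦ ?_
    have hjn := Finset.mem_range.mp hj
    rw [show 2 * n - (n - 1 - j) = n + 1 + j by lia, show n - (n - 1 - j) = j + 1 by lia,
      choose_mul_two_mul_div hjn, add_mul]
  obtain ⟨m, rfl⟩ : ∃ m, n = m + 1 := ⟨n - 1, by lia⟩
  have hB := sum_choose_two_mul_add_sum hyz hx m
  rw [Finset.sum_range_succ' _ (m + 1), Finset.sum_range_succ' (fun j ↦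
    ((m + j).choose (2 * j) : ℂ) * (x : ℂ) ^ j) m] at hB
  rw [hsum, Finset.sum_add_distrib, Finset.sum_range_succ (fun j ↦
    ((m + 1 - 1 + (j + 1)).choose (2 * (j + 1)) : ℝ) * x ^ (j + 1)) m,
    Nat.choose_eq_zero_of_lt (by lia : m + 1 - 1 + (m + 1) < 2 * (m + 1))]
  apply Complex.ofReal_injective
  have hP := prod_add_four_mul_sin_sq m.succ_ne_zero hyz hx
  push_cast at hP hB ⊢
  rw [hP, ← hB]
  simp
  ring
end

section
/- Let G be a connected, locally finite simple graph with infinite vertex set, whose vertex degrees are uniformly bounded. If f : V(G) → ℝ is square-summable (∑_v f(v)² < ∞) and harmonic at every vertex, i.e., for every vertex v one has ∑_{u adjacent to v} ( f(v) − f(u) ) = 0, then f is identically zero. (Equivalently: 0 is an eigenvalue of the graph Laplacian on ℓ²(V) if and only if the connected graph G is finite.) -/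
/-- A function which is nonzero somewhere and whose square vanishes at infinity attains its
maximal absolute value, at a point where it is nonzero. -/
theorem exists_sq_max {V : Type*} {f : V → ℝ}
    (hlim : Filter.Tendsto (fun v => f v ^ 2) Filter.cofinite (nhds 0)) {v : V} (hv : f v ≠ 0) :
    ∃ w, f w ≠ 0 ∧ ∀ u, f u ^ 2 ≤ f w ^ 2 := by
  have hpos : 0 < f v ^ 2 := by positivity
  have hfin : {u | f v ^ 2 ≤ f u ^ 2}.Finite := by
    simpa [Filter.eventually_cofinite] using hlim.eventually_lt_const hpos
  obtain ⟨w, hw, hmax⟩ := Set.exists_max_image _ (fun u => f u ^ 2) hfin ⟨v, le_refl (f v ^ 2)⟩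
  have hvw : f v ^ 2 ≤ f w ^ 2 := hw
  refine ⟨w, fun h => ?_, fun u => ?_⟩
  · simp only [h] at hvw
    linarith
  · by_cases hu : f v ^ 2 ≤ f u ^ 2
    · exact hmax u hu
    · linarith

/-- Maximum principle: a harmonic function attaining its maximal absolute value at `w` is constant
on the connected component of `w`. -/
theorem eq_of_reachable_of_harmonic {V : Type*} (G : SimpleGraph V) [G.LocallyFinite]
    {f : V → ℝ} (hharm : ∀ v : V, ∑ u ∈ G.neighborFinset v, (f v - f u) = 0)
    {w : V} (hw : f w ≠ 0) (hmax : ∀ u, f u ^ 2 ≤ f w ^ 2) {x : V} (hx : G.Reachable w x) :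
    f x = f w := by
  rw [SimpleGraph.reachable_iff_reflTransGen] at hx
  induction hx with
  | refl => rfl
  | @tail x u _ hadj hxw =>
    have hsum : ∑ u ∈ G.neighborFinset x, (f x - f u) * f w = 0 := by
      rw [← Finset.sum_mul, hharm, zero_mul]
    have hzero := (Finset.sum_eq_zero_iff_of_nonneg fun y _ => by
      rw [hxw]
      nlinarith [hmax y, sq_nonneg (f w - f y)]).mp hsum u (by simpa using hadj)
    have hxu := (mul_eq_zero.mp hzero).resolve_right hw
    linarith

/-- A connected, infinite graph of uniformly bounded degree admits no nonzero square-summable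
harmonic function: if `∑_v f(v)² < ∞` and `∑_{u ~ v} (f(v) − f(u)) = 0` for all `v`, then
`f = 0`.  (Equivalently, `0` is an eigenvalue of the graph Laplacian on `ℓ²(V)` iff the
connected graph is finite.) -/
theorem harmonic_l2_eq_zero {V : Type*} [Infinite V] (G : SimpleGraph V)
    [DecidableRel G.Adj] [G.LocallyFinite]
    (hconn : G.Connected) (D : ℕ) (hdeg : ∀ v : V, G.degree v ≤ D)
    (f : V → ℝ) (hsq : Summable fun v => f v ^ 2)
    (hharm : ∀ v : V, ∑ u ∈ G.neighborFinset v, (f v - f u) = 0) :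
    f = 0 := by
  have hlim : Filter.Tendsto (fun v => f v ^ 2) Filter.cofinite (nhds 0) :=
    hsq.tendsto_cofinite_zero
  by_contra hne
  obtain ⟨v, hv⟩ := Function.ne_iff.mp hne
  obtain ⟨w, hw, hmax⟩ := exists_sq_max hlim hv
  have hconst : ∀ u, f u = f w := fun u =>
    eq_of_reachable_of_harmonic G hharm hw hmax (hconn.preconnected w u)
  simp only [hconst] at hlim
  exact hw (by simpa using tendsto_nhds_unique tendsto_const_nhds hlim)
end

section
/- For every complex number s with Re(s) < 1/2, the integral ∫_0^4 x^{−s} / (π·√(x(4−x))) dx converges and equals Γ(1−2s) / Γ(1−s)², where Γ is the complex Gamma function. Equivalently, ζ_ℤ(s) = 4^{−s}·Γ(1/2−s) / (√π·Γ(1−s)) = Γ(1−2s)/Γ(1−s)², the generalized central binomial coefficient C(−2s, −s). -/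
open Real MeasureTheory Complex

/-- The spectral density of `ℤ` against `x ^ (-s)` is a rescaled Beta integrand. -/
lemma cpow_div_arcsine_density_eq (s : ℂ) {x : ℝ} (hx : x ∈ Set.Ioo (0 : ℝ) 4) :
    (x : ℂ) ^ (-s) / ((π * Real.sqrt (x * (4 - x)) : ℝ) : ℂ) =
      (4 : ℂ) ^ (-s) / (4 * π) *
        (((x / 4 : ℝ) : ℂ) ^ ((1 / 2 - s) - 1) *
          (1 - ((x / 4 : ℝ) : ℂ)) ^ ((1 / 2 : ℂ) - 1)) := by
  obtain ⟨t, rfl⟩ : ∃ t : ℝ, x = 4 * t := ⟨x / 4, by ring⟩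
  have ht : 0 < t := by linarith [hx.1]
  have ht' : 0 < 1 - t := by linarith [hx.2]
  have hsqrt : Real.sqrt (4 * t * (4 - 4 * t)) = 4 * (Real.sqrt t * Real.sqrt (1 - t)) := by
    rw [← Real.sqrt_mul ht.le, show 4 * t * (4 - 4 * t) = 4 ^ 2 * (t * (1 - t)) by ring,
      Real.sqrt_mul (by positivity), Real.sqrt_sq (by norm_num)]
  have hcpow {y : ℝ} (hy : 0 < y) : (y : ℂ) ^ (-(1 / 2) : ℂ) = ((Real.sqrt y : ℝ) : ℂ)⁻¹ := by
    rw [Complex.cpow_neg, Real.sqrt_eq_rpow, Complex.ofReal_cpow hy.le]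
    norm_num
  have hmul : ((4 * t : ℝ) : ℂ) ^ (-s) = (4 : ℂ) ^ (-s) * (t : ℂ) ^ (-s) := by
    rw [Complex.ofReal_mul, Complex.mul_cpow_ofReal_nonneg (by norm_num) ht.le]
    norm_num
  have h1 : (1 : ℂ) - (t : ℂ) = ((1 - t : ℝ) : ℂ) := by push_cast; rfl
  rw [mul_div_cancel_left₀ t (by norm_num : (4 : ℝ) ≠ 0), h1, hmul, hsqrt,
    show (1 / 2 - s) - 1 = -s + -(1 / 2) by ring, show (1 / 2 : ℂ) - 1 = -(1 / 2) by ring,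
    Complex.cpow_add _ _ (Complex.ofReal_ne_zero.2 ht.ne'), hcpow ht, hcpow ht']
  push_cast
  simp only [div_eq_mul_inv, mul_inv]
  ring

/-- The Legendre duplication formula, as a closed form for central binomial coefficients. -/
lemma Gamma_one_sub_two_mul_div_sq (s : ℂ) (hs : Complex.Gamma (1 - s) ≠ 0) :
    Complex.Gamma (1 - 2 * s) / Complex.Gamma (1 - s) ^ 2
      = (4 : ℂ) ^ (-s) * Complex.Gamma (1 / 2 - s)
          / ((Real.sqrt π : ℂ) * Complex.Gamma (1 - s)) := by
  have hdup := Complex.Gamma_mul_Gamma_add_half (1 / 2 - s)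
  rw [show 1 / 2 - s + 1 / 2 = 1 - s by ring, show 2 * (1 / 2 - s) = 1 - 2 * s by ring,
    show 1 - (1 - 2 * s) = s + s by ring, Complex.cpow_add _ _ two_ne_zero] at hdup
  have hfour : (4 : ℂ) ^ (-s) * ((2 : ℂ) ^ s * (2 : ℂ) ^ s) = 1 := by
    have h := Complex.mul_cpow_ofReal_nonneg (a := 2) (b := 2) (by norm_num) (by norm_num) s
    norm_num at h
    rw [← h, ← Complex.cpow_add _ _ (by norm_num : (4 : ℂ) ≠ 0)]
    simp
  have hpi : ((Real.sqrt π : ℝ) : ℂ) ≠ 0 :=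
    Complex.ofReal_ne_zero.2 (Real.sqrt_pos.2 Real.pi_pos).ne'
  rw [div_eq_div_iff (pow_ne_zero 2 hs) (mul_ne_zero hpi hs)]
  linear_combination (-(4 : ℂ) ^ (-s) * Complex.Gamma (1 - s)) * hdup -
    (Complex.Gamma (1 - 2 * s) * (Real.sqrt π : ℂ) * Complex.Gamma (1 - s)) * hfour

/-- For `Re s < 1/2` the integral `∫_0^4 x^{−s}/(π√(x(4−x))) dx` converges and equals
`Γ(1−2s)/Γ(1−s)²`; equivalently `ζ_ℤ(s) = 4^{−s}Γ(1/2−s)/(√π·Γ(1−s))`, the generalized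
central binomial coefficient `C(−2s,−s)`. -/
theorem zeta_Z_closed_form (s : ℂ) (hs : s.re < 1 / 2) :
    IntegrableOn
        (fun x : ℝ => (x : ℂ) ^ (-s) / ((π * Real.sqrt (x * (4 - x)) : ℝ) : ℂ))
        (Set.Ioo (0 : ℝ) 4) ∧
    (∫ x in Set.Ioo (0 : ℝ) 4, (x : ℂ) ^ (-s) / ((π * Real.sqrt (x * (4 - x)) : ℝ) : ℂ))
        = Complex.Gamma (1 - 2 * s) / Complex.Gamma (1 - s) ^ 2 ∧
    Complex.Gamma (1 - 2 * s) / Complex.Gamma (1 - s) ^ 2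
        = (4 : ℂ) ^ (-s) * Complex.Gamma (1 / 2 - s)
            / ((Real.sqrt π : ℂ) * Complex.Gamma (1 - s)) := by
  have hu : 0 < (1 / 2 - s).re := by
    simp only [Complex.sub_re]; norm_num at hs ⊢; linarith
  have hv : 0 < (1 / 2 : ℂ).re := by norm_num
  have hG : Complex.Gamma (1 - s) ≠ 0 := Complex.Gamma_ne_zero_of_re_pos (by
    simp only [Complex.sub_re, Complex.one_re]; linarith)
  have hEq := Gamma_one_sub_two_mul_div_sq s hG
  refine ⟨?_, ?_, hEq⟩
  · rw [integrableOn_congr_fun (fun x hx => cpow_div_arcsine_density_eq s hx) measurableSet_Ioo]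
    have h := (Complex.betaIntegral_convergent hu hv).comp_mul_left (c := (4 : ℝ)⁻¹)
    norm_num at h
    rw [intervalIntegrable_iff_integrableOn_Ioo_of_le (by norm_num)] at h
    refine Integrable.const_mul ?_ _
    refine h.congr (Filter.Eventually.of_forall fun x => ?_)
    push_cast
    norm_num [div_eq_inv_mul]
  · rw [setIntegral_congr_fun measurableSet_Ioo (fun x hx => cpow_div_arcsine_density_eq s hx),
      ← integral_Ioc_eq_integral_Ioo, ← intervalIntegral.integral_of_le (by norm_num),
      intervalIntegral.integral_const_mul,
      intervalIntegral.integral_comp_div (fun t : ℝ => (t : ℂ) ^ ((1 / 2 - s) - 1) *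
          (1 - (t : ℂ)) ^ ((1 / 2 : ℂ) - 1)) (by norm_num : (4 : ℝ) ≠ 0),
      zero_div, div_self (by norm_num : (4 : ℝ) ≠ 0), ← Complex.betaIntegral,
      Complex.betaIntegral_eq_Gamma_mul_div _ _ hu hv, hEq,
      show 1 / 2 - s + 1 / 2 = 1 - s by ring, Complex.Gamma_one_half_eq]
    have hsq : (π : ℂ) ^ (1 / 2 : ℂ) = ((Real.sqrt π : ℝ) : ℂ) := by
      rw [Real.sqrt_eq_rpow, Complex.ofReal_cpow Real.pi_pos.le]
      norm_num
    have hpi : ((Real.sqrt π : ℝ) : ℂ) ≠ 0 :=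
      Complex.ofReal_ne_zero.2 (Real.sqrt_pos.2 Real.pi_pos).ne'
    have hpi2 : (π : ℂ) = ((Real.sqrt π : ℝ) : ℂ) ^ 2 := by
      rw [← Complex.ofReal_pow, Real.sq_sqrt Real.pi_pos.le]
    rw [hsq, Complex.real_smul]
    nth_rewrite 1 [hpi2]
    push_cast
    field_simp
end

section
/- For every natural number k, the meromorphic function s ↦ Γ(1−2s)/Γ(1−s)² (the meromorphic continuation of ζ_ℤ) has a simple pole at s = k + 1/2 with residue −C(2k,k)/(π·2^{4k+1}); that is, (s − (k+1/2)) · Γ(1−2s)/Γ(1−s)² tends to −C(2k,k)/(π·2^{4k+1}) as s → k + 1/2 (s ≠ k+1/2). Here C(2k,k) is the central binomial coefficient. -/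
open Real Complex Filter

/-- The functional equation of `s ↦ Γ(1−2s)/Γ(1−s)²` under `s ↦ s + 1`. -/
lemma Gamma_one_sub_two_mul_div_sq_add_one {s : ℂ} (hs : s ≠ 0) (hs' : 2 * s + 1 ≠ 0) :
    Complex.Gamma (1 - 2 * (s + 1)) / Complex.Gamma (1 - (s + 1)) ^ 2 =
      s / (2 * (2 * s + 1)) * (Complex.Gamma (1 - 2 * s) / Complex.Gamma (1 - s) ^ 2) := by
  have hneg : -(2 * s + 1) ≠ 0 := neg_ne_zero.mpr hs'
  have h1 : Complex.Gamma (1 - 2 * s) =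
      (-(2 * s)) * (-(2 * s + 1) * Complex.Gamma (-(2 * s + 1))) := by
    rw [← Complex.Gamma_add_one _ hneg, show -(2 * s + 1) + 1 = -(2 * s) by ring,
      ← Complex.Gamma_add_one _ (by simpa using hs)]
    ring_nf
  have h2 : Complex.Gamma (1 - s) = -s * Complex.Gamma (-s) := by
    rw [← Complex.Gamma_add_one _ (neg_ne_zero.mpr hs)]
    ring_nf
  rw [h1, h2, show 1 - 2 * (s + 1) = -(2 * s + 1) by ring, show 1 - (s + 1) = -s by ring]
  by_cases h0 : Complex.Gamma (-s) = 0
  · simp [h0]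
  · field_simp

lemma tendsto_mul_Gamma_one_sub_two_mul_div_sq (k : ℕ) :
    Tendsto
      (fun h : ℂ => h * (Complex.Gamma (1 - 2 * (k + 1 / 2 + h)) /
        Complex.Gamma (1 - (k + 1 / 2 + h)) ^ 2))
      (nhdsWithin 0 {0}ᶜ)
      (nhds (-(((2 * k).choose k : ℂ) / ((π : ℂ) * 2 ^ (4 * k + 1))))) := by
  induction k with
  | zero =>
    have hpole : Tendsto (fun h : ℂ => (-2 * h) * Complex.Gamma (-2 * h))
        (nhdsWithin 0 {0}ᶜ) (nhds 1) := by
      refine Complex.tendsto_self_mul_Gamma_nhds_zero.comp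
        (tendsto_nhdsWithin_iff.mpr ⟨?_, ?_⟩)
      · have : ContinuousAt (fun h : ℂ => -2 * h) 0 := by fun_prop
        simpa only [mul_zero] using this.tendsto.mono_left nhdsWithin_le_nhds
      · filter_upwards [self_mem_nhdsWithin] with h hh
        simpa using hh
    have hden : Tendsto (fun h : ℂ => (Complex.Gamma (1 / 2 - h))⁻¹)
        (nhdsWithin 0 {0}ᶜ) (nhds (Complex.Gamma (1 / 2))⁻¹) := by
      have : ContinuousAt (fun h : ℂ => (Complex.Gamma (1 / 2 - h))⁻¹) 0 :=
        (Complex.differentiable_one_div_Gamma.continuous.comp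
          (continuous_const.sub continuous_id)).continuousAt
      simpa using this.tendsto.mono_left nhdsWithin_le_nhds
    have hsq : Complex.Gamma (1 / 2) ^ 2 = π := by
      rw [Complex.Gamma_one_half_eq, ← Complex.cpow_nat_mul]
      simp
    have hlim := (hpole.mul (hden.pow 2)).const_mul (-1 / 2 : ℂ)
    rw [inv_pow, hsq] at hlim
    convert hlim using 2 with h
    · rw [Nat.cast_zero, show 1 - 2 * (0 + 1 / 2 + h) = -2 * h by ring,
        show 1 - (0 + 1 / 2 + h) = 1 / 2 - h by ring]
      ring
    · simp
      ring
  | succ k ih =>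
    have hk : (k : ℂ) + 1 ≠ 0 := Nat.cast_add_one_ne_zero k
    have h2k : (2 * k + 1 : ℂ) ≠ 0 := by exact_mod_cast (2 * k).succ_ne_zero
    have hs : (k + 1 / 2 + 0 : ℂ) ≠ 0 := by
      rw [show (k + 1 / 2 + 0 : ℂ) = (2 * k + 1) / 2 by ring]
      exact div_ne_zero h2k two_ne_zero
    have hs' : (2 * (k + 1 / 2 + 0) + 1 : ℂ) ≠ 0 := by
      rw [show (2 * (k + 1 / 2 + 0) + 1 : ℂ) = 2 * (k + 1) by ring]
      exact mul_ne_zero two_ne_zero hk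
    have hfac : ContinuousAt
        (fun h : ℂ => (k + 1 / 2 + h) / (2 * (2 * (k + 1 / 2 + h) + 1))) 0 :=
      ContinuousAt.div (by fun_prop) (by fun_prop) (mul_ne_zero two_ne_zero hs')
    have hlim := (hfac.tendsto.mono_left nhdsWithin_le_nhds).mul ih
    have hval : (k + 1 / 2 + 0 : ℂ) / (2 * (2 * (k + 1 / 2 + 0) + 1)) *
        -(((2 * k).choose k : ℂ) / ((π : ℂ) * 2 ^ (4 * k + 1))) =
        -(((2 * (k + 1)).choose (k + 1) : ℂ) / ((π : ℂ) * 2 ^ (4 * (k + 1) + 1))) := by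
      have hrec : ((k : ℂ) + 1) * ((2 * (k + 1)).choose (k + 1) : ℂ) =
          2 * (2 * k + 1) * ((2 * k).choose k : ℂ) := by
        exact_mod_cast Nat.succ_mul_centralBinom_succ k
      have hc : ((2 * (k + 1)).choose (k + 1) : ℂ) =
          2 * (2 * k + 1) * ((2 * k).choose k : ℂ) / (k + 1) := by
        rw [eq_div_iff hk, ← hrec, mul_comm]
      have hπ : (π : ℂ) ≠ 0 := by exact_mod_cast Real.pi_ne_zero
      rw [hc, show (2 * (k + 1 / 2 + 0) + 1 : ℂ) = 2 * (k + 1) by ring]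
      field_simp
      ring
    rw [hval] at hlim
    refine hlim.congr' ?_
    have e1 : ∀ᶠ h : ℂ in nhds 0, (k + 1 / 2 + h : ℂ) ≠ 0 :=
      ContinuousAt.eventually_ne (by fun_prop) hs
    have e2 : ∀ᶠ h : ℂ in nhds 0, (2 * (k + 1 / 2 + h) + 1 : ℂ) ≠ 0 :=
      ContinuousAt.eventually_ne (by fun_prop) hs'
    filter_upwards [nhdsWithin_le_nhds e1, nhdsWithin_le_nhds e2] with h h1 h2
    rw [show (((k + 1 : ℕ) : ℂ) + 1 / 2 + h) = (k + 1 / 2 + h) + 1 by push_cast; ring,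
      Gamma_one_sub_two_mul_div_sq_add_one h1 h2]
    ring

/-- The meromorphic continuation `s ↦ Γ(1−2s)/Γ(1−s)²` of `ζ_ℤ` has a simple pole at
`s = k + 1/2` with residue `−C(2k,k)/(π·2^{4k+1})`: the function
`(s − (k+1/2))·Γ(1−2s)/Γ(1−s)²` tends to that value as `s → k+1/2`, `s ≠ k+1/2`. -/
theorem zeta_Z_residue (k : ℕ) :
    Tendsto
      (fun s : ℂ =>
        (s - ((k : ℂ) + 1 / 2)) * (Complex.Gamma (1 - 2 * s) / Complex.Gamma (1 - s) ^ 2))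
      (nhdsWithin ((k : ℂ) + 1 / 2) {((k : ℂ) + 1 / 2)}ᶜ)
      (nhds (-(((2 * k).choose k : ℂ) / ((π : ℂ) * 2 ^ (4 * k + 1))))) := by
  have hshift : Tendsto (fun s : ℂ => s - ((k : ℂ) + 1 / 2))
      (nhdsWithin ((k : ℂ) + 1 / 2) {((k : ℂ) + 1 / 2)}ᶜ) (nhdsWithin 0 {0}ᶜ) := by
    refine tendsto_nhdsWithin_iff.mpr ⟨?_, ?_⟩
    · have : ContinuousAt (fun s : ℂ => s - ((k : ℂ) + 1 / 2)) (k + 1 / 2) := by fun_prop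
      simpa using this.tendsto.mono_left nhdsWithin_le_nhds
    · filter_upwards [self_mem_nhdsWithin] with s hs
      exact sub_ne_zero.mpr hs
  refine ((tendsto_mul_Gamma_one_sub_two_mul_div_sq k).comp hshift).congr fun s => ?_
  simp only [Function.comp_apply, add_sub_cancel]
end

section
/- Let n be a positive natural number and let μ and ν be Borel probability measures on ℝ supported in [0,R] for some R > 0, such that ∫ y^k μ(dy) = ∫ y^k ν(dy) for every natural number k ≤ n. Then the difference of regularized determinants x ↦ exp(∫ log(x+y) μ(dy)) − exp(∫ log(x+y) ν(dy)) is O(x^{−n}) as x → +∞. (This is the statement that if two rooted graphs are n-similar, then det*(x+Δ_G) = det*(x+Δ_F) + O(x^{−n}).) -/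
open MeasureTheory Asymptotics Filter

theorem integrable_of_continuousOn_Icc_of_measure_compl_eq_zero {μ : Measure ℝ}
    [IsFiniteMeasure μ] {a b : ℝ} (hμ : μ (Set.Icc a b)ᶜ = 0) {f : ℝ → ℝ}
    (hf : ContinuousOn f (Set.Icc a b)) : Integrable f μ := by
  have h := hf.integrableOn_compact (μ := μ) isCompact_Icc
  have hmem : ∀ᵐ y ∂μ, y ∈ Set.Icc a b := mem_ae_iff.mpr hμ
  rwa [IntegrableOn, Measure.restrict_eq_self_of_ae_mem hmem] at h

theorem continuousOn_log_const_add {R x : ℝ} (hx : 0 < x) :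
    ContinuousOn (fun y => Real.log (x + y)) (Set.Icc 0 R) :=
  ContinuousOn.log (by fun_prop) fun y hy => by have := hy.1; positivity

/-- Pointwise Taylor estimate for `log (x + y)` as `x` dominates `y`. -/
theorem abs_log_add_sub_taylor_le (n : ℕ) {R x y : ℝ} (hx : 0 < x) (hRx : 2 * R ≤ x)
    (hy : y ∈ Set.Icc 0 R) :
    |Real.log (x + y) - (Real.log x - ∑ i ∈ Finset.range n, (-x⁻¹) ^ (i + 1) / (i + 1)
      * y ^ (i + 1))| ≤ 2 * (R / x) ^ (n + 1) := by
  obtain ⟨hy0, hyR⟩ := hy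
  have ht0 : 0 ≤ y / x := by positivity
  have ht : y / x ≤ 1 / 2 := by rw [div_le_iff₀ hx]; linarith
  have habs : |-(y / x)| = y / x := by rw [abs_neg, abs_of_nonneg ht0]
  have key := Real.abs_log_sub_add_sum_range_le (x := -(y / x)) (by rw [habs]; linarith) n
  rw [habs] at key
  have hlog : Real.log (x + y) = Real.log x + Real.log (1 - -(y / x)) := by
    rw [← Real.log_mul hx.ne' (by linarith)]
    congr 1
    field_simp
    ring
  have hsum : ∑ i ∈ Finset.range n, (-x⁻¹) ^ (i + 1) / ((i : ℝ) + 1) * y ^ (i + 1)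
      = ∑ i ∈ Finset.range n, (-(y / x)) ^ (i + 1) / ((i : ℝ) + 1) := by
    refine Finset.sum_congr rfl fun i _ => ?_
    rw [show -(y / x) = -x⁻¹ * y by ring, mul_pow]
    ring
  rw [hlog, hsum]
  calc _ = |(∑ i ∈ Finset.range n, (-(y / x)) ^ (i + 1) / ((i : ℝ) + 1))
          + Real.log (1 - -(y / x))| := by congr 1; ring
    _ ≤ (y / x) ^ (n + 1) / (1 - y / x) := key
    _ ≤ (y / x) ^ (n + 1) / (1 / 2) := by gcongr; linarith
    _ = 2 * (y / x) ^ (n + 1) := by ring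
    _ ≤ 2 * (R / x) ^ (n + 1) := by gcongr

/-- Moment expansion of `∫ log (x + y) dμ(y)` for a probability measure on `[0, R]`. -/
theorem abs_integral_log_add_sub_le (n : ℕ) {R x : ℝ} (hx : 0 < x) (hRx : 2 * R ≤ x)
    {μ : Measure ℝ} [IsProbabilityMeasure μ] (hμ : μ (Set.Icc 0 R)ᶜ = 0) :
    |∫ y, Real.log (x + y) ∂μ - (Real.log x - ∑ i ∈ Finset.range n, (-x⁻¹) ^ (i + 1) / (i + 1)
      * ∫ y, y ^ (i + 1) ∂μ)| ≤ 2 * (R / x) ^ (n + 1) := by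
  have hpow : ∀ i ∈ Finset.range n,
      Integrable (fun y : ℝ => (-x⁻¹) ^ (i + 1) / ((i : ℝ) + 1) * y ^ (i + 1)) μ := fun i _ =>
    integrable_of_continuousOn_Icc_of_measure_compl_eq_zero hμ (by fun_prop)
  have hlog := integrable_of_continuousOn_Icc_of_measure_compl_eq_zero hμ
    (continuousOn_log_const_add (R := R) hx)
  have hint : ∫ y, (Real.log (x + y) - (Real.log x - ∑ i ∈ Finset.range n,
      (-x⁻¹) ^ (i + 1) / ((i : ℝ) + 1) * y ^ (i + 1))) ∂μ
      = ∫ y, Real.log (x + y) ∂μ - (Real.log x - ∑ i ∈ Finset.range n,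
        (-x⁻¹) ^ (i + 1) / ((i : ℝ) + 1) * ∫ y, y ^ (i + 1) ∂μ) := by
    have htaylor : Integrable (fun y : ℝ => Real.log x - ∑ i ∈ Finset.range n,
        (-x⁻¹) ^ (i + 1) / ((i : ℝ) + 1) * y ^ (i + 1)) μ :=
      (integrable_const _).sub (integrable_finsetSum _ hpow)
    rw [integral_sub hlog htaylor, integral_sub (integrable_const _) (integrable_finsetSum _ hpow),
      integral_finsetSum _ hpow]
    simp [integral_const_mul]
  rw [← hint]
  have h := norm_integral_le_of_norm_le_const (μ := μ)
    (f := fun y => Real.log (x + y) - (Real.log x - ∑ i ∈ Finset.range n,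
      (-x⁻¹) ^ (i + 1) / ((i : ℝ) + 1) * y ^ (i + 1))) (C := 2 * (R / x) ^ (n + 1))
    (Filter.Eventually.mono (mem_ae_iff.mpr hμ)
      fun y hy => abs_log_add_sub_taylor_le n hx hRx hy)
  simpa using h

theorem exp_integral_log_add_le {R x : ℝ} (hx : 0 < x) (hR : 0 < R)
    {μ : Measure ℝ} [IsProbabilityMeasure μ] (hμ : μ (Set.Icc 0 R)ᶜ = 0) :
    Real.exp (∫ y, Real.log (x + y) ∂μ) ≤ x + R := by
  have hle : ∫ y, Real.log (x + y) ∂μ ≤ ∫ _, Real.log (x + R) ∂μ :=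
    integral_mono_ae (integrable_of_continuousOn_Icc_of_measure_compl_eq_zero hμ
      (continuousOn_log_const_add hx)) (integrable_const _)
      (Filter.Eventually.mono (mem_ae_iff.mpr hμ) fun y hy =>
        Real.log_le_log (by linarith [hy.1]) (by linarith [hy.2]))
  rw [integral_const, probReal_univ, one_smul] at hle
  exact (Real.le_log_iff_exp_le (by positivity)).mp hle

theorem abs_exp_sub_exp_le_of_exp_le {a b M : ℝ} (ha : Real.exp a ≤ M) (hb : Real.exp b ≤ M) :
    |Real.exp a - Real.exp b| ≤ M * |a - b| := by
  have exp_sub_le : ∀ u v : ℝ, Real.exp u ≤ M → Real.exp u - Real.exp v ≤ M * |u - v| := by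
    intro u v hu
    calc Real.exp u - Real.exp v = Real.exp u * (1 - Real.exp (v - u)) := by
          rw [mul_sub, ← Real.exp_add]; simp
      _ ≤ Real.exp u * |u - v| := by
          gcongr
          linarith [Real.add_one_le_exp (v - u), le_abs_self (u - v)]
      _ ≤ M * |u - v| := by gcongr
  rw [abs_le]
  constructor
  · linarith [abs_sub_comm a b ▸ exp_sub_le b a hb]
  · exact exp_sub_le a b ha

/-- If two Borel probability measures supported in `[0,R]` have equal `k`-th moments for all
`k ≤ n`, then the corresponding regularized determinants differ by `O(x^{−n})` as `x → +∞`.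
(This is: if two rooted graphs are `n`-similar then `det*(x+Δ_G) = det*(x+Δ_F) + O(x^{−n})`.) -/
theorem regularized_det_of_similar (n : ℕ) (hn : 0 < n) (R : ℝ) (hR : 0 < R)
    (μ ν : Measure ℝ) [IsProbabilityMeasure μ] [IsProbabilityMeasure ν]
    (hμ : μ (Set.Icc 0 R)ᶜ = 0) (hν : ν (Set.Icc 0 R)ᶜ = 0)
    (hmom : ∀ k ≤ n, ∫ y, y ^ k ∂μ = ∫ y, y ^ k ∂ν) :
    (fun x : ℝ =>
        Real.exp (∫ y, Real.log (x + y) ∂μ) - Real.exp (∫ y, Real.log (x + y) ∂ν))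
      =O[atTop] fun x : ℝ => (x ^ n)⁻¹ := by
  refine IsBigO.of_bound (8 * R ^ (n + 1)) ?_
  filter_upwards [eventually_ge_atTop (2 * R)] with x hRx
  have hx : 0 < x := by linarith
  have hμx := abs_integral_log_add_sub_le n hx hRx hμ
  have hνx := abs_integral_log_add_sub_le n hx hRx hν
  rw [Finset.sum_congr rfl fun i hi => by
    rw [hmom (i + 1) (Finset.mem_range.mp hi)]] at hμx
  have hdiff : |∫ y, Real.log (x + y) ∂μ - ∫ y, Real.log (x + y) ∂ν|
      ≤ 4 * (R / x) ^ (n + 1) := by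
    rw [abs_le] at *
    constructor <;> linarith [hμx.1, hμx.2, hνx.1, hνx.2]
  rw [Real.norm_eq_abs, Real.norm_of_nonneg (by positivity)]
  calc _ ≤ 2 * x * |∫ y, Real.log (x + y) ∂μ - ∫ y, Real.log (x + y) ∂ν| :=
        abs_exp_sub_exp_le_of_exp_le ((exp_integral_log_add_le hx hR hμ).trans (by linarith))
          ((exp_integral_log_add_le hx hR hν).trans (by linarith))
    _ ≤ 2 * x * (4 * (R / x) ^ (n + 1)) := by gcongr
    _ = 8 * R ^ (n + 1) * (x ^ n)⁻¹ := by
        rw [div_pow, pow_succ x n]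
        field_simp
        ring
end

section
/- For all natural numbers n ≥ 1 and l with 0 ≤ l ≤ n−1, ∑_{k=0}^{2n} C(2n, k) · B(k/2, l) · 4^{l−n} = (2n/(2n−l)) · C(2n−l, l), where C(2n,k) is the ordinary binomial coefficient and B(k/2, l) = ( ∏_{j=0}^{l−1} (k/2 − j) ) / l! is the generalized binomial coefficient of the half-integer k/2 over l. -/
open Polynomial in
/-- The Pascal step `(x + 1)_{l+1} = (x + 1) (x)_l` for falling factorials. -/
theorem descPochhammer_eval_add_one_succ {R : Type*} [CommRing R] (x : R) (l : ℕ) :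
    (descPochhammer R (l + 1)).eval (x + 1) = (x + 1) * (descPochhammer R l).eval x := by
  simp [descPochhammer_succ_left, eval_comp]

/-- The binomial transform of the falling factorials `(k / 2)_l`, that is, `l!` times the
coefficient of `y ^ l` in `(1 + √(1 + y)) ^ m`. -/
noncomputable def halfFallingSum (m l : ℕ) : ℝ :=
  ∑ k ∈ Finset.range (m + 1), (m.choose k : ℝ) * (descPochhammer ℝ l).eval ((k : ℝ) / 2)

theorem halfFallingSum_zero_right (m : ℕ) : halfFallingSum m 0 = 2 ^ m := by
  simp only [halfFallingSum, descPochhammer_zero, Polynomial.eval_one, mul_one]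
  exact_mod_cast Nat.sum_range_choose m

theorem sum_choose_succ_mul_eq {R : Type*} [CommSemiring R] (f : ℕ → R) (m : ℕ) :
    ∑ k ∈ Finset.range (m + 2), ((m + 1).choose k : R) * f k =
      ∑ k ∈ Finset.range (m + 1), (m.choose k : R) * (f k + f (k + 1)) := by
  rw [Finset.sum_choose_succ_mul (fun i _ => f i) m]
  simp only [mul_add, Finset.sum_add_distrib]

theorem halfFallingSum_add_two (m l : ℕ) :
    halfFallingSum (m + 2) (l + 1) =
      2 * halfFallingSum (m + 1) (l + 1) + (l + 1) * halfFallingSum m l := by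
  simp only [halfFallingSum]
  rw [sum_choose_succ_mul_eq _ (m + 1), sum_choose_succ_mul_eq _ m, sum_choose_succ_mul_eq _ m,
    Finset.mul_sum, Finset.mul_sum, ← Finset.sum_add_distrib]
  refine Finset.sum_congr rfl fun k _ => ?_
  have h : (((k + 1 + 1 : ℕ) : ℝ) / 2) = (k : ℝ) / 2 + 1 := by push_cast; ring
  rw [h, descPochhammer_eval_add_one_succ, descPochhammer_succ_eval l ((k : ℝ) / 2)]
  ring

theorem four_pow_mul_descPochhammer_eval_half (l : ℕ) :
    4 ^ (l + 1) * (descPochhammer ℝ (l + 1)).eval (1 / 2) =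
      2 * (descPochhammer ℝ l).eval (-(l : ℝ) - 1) := by
  induction l with
  | zero => norm_num
  | succ l ih =>
    have h₁ := descPochhammer_eval_add_one_succ (-(l : ℝ) - 2) l
    rw [show -(l : ℝ) - 2 + 1 = -(l : ℝ) - 1 by ring, descPochhammer_succ_eval] at h₁
    rw [descPochhammer_succ_eval (l + 1), pow_succ]
    push_cast
    rw [show -((l : ℝ) + 1) - 1 = -(l : ℝ) - 2 by ring, descPochhammer_succ_eval l (-(l : ℝ) - 2)]
    linear_combination (2 * (-1 - 2 * (l : ℝ))) * ih + 4 * h₁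

theorem four_pow_mul_halfFallingSum_succ (m l : ℕ) :
    4 ^ (l + 1) * halfFallingSum m (l + 1) =
      2 ^ m * m * (descPochhammer ℝ l).eval ((m : ℝ) - l - 2) := by
  induction m using Nat.twoStepInduction generalizing l with
  | zero => simp [halfFallingSum, descPochhammer_succ_left]
  | one =>
    have h := four_pow_mul_descPochhammer_eval_half l
    have h₀ : (descPochhammer ℝ (l + 1)).eval 0 = 0 :=
      descPochhammer_ne_zero_eval_zero ℝ l.succ_ne_zero
    simp only [halfFallingSum, Finset.sum_range_succ, Finset.sum_range_zero]
    norm_num [h₀] at h ⊢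
    rw [h, show (1 : ℝ) - l - 2 = -l - 1 by ring]
  | more m ih₀ ih₁ =>
    rw [halfFallingSum_add_two]
    cases l with
    | zero =>
      have h := ih₁ 0
      rw [halfFallingSum_zero_right]
      simp only [descPochhammer_zero, Polynomial.eval_one] at h ⊢
      push_cast at h ⊢
      linear_combination 2 * h
    | succ l =>
      have h₀ := ih₀ l
      have h₁ := ih₁ (l + 1)
      have h₂ := descPochhammer_eval_add_one_succ ((m : ℝ) - l - 2) l
      push_cast at h₀ h₁ ⊢
      rw [show (m : ℝ) + 1 - (l + 1) - 2 = m - l - 2 by ring, descPochhammer_succ_eval] at h₁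
      rw [show (m : ℝ) + 2 - (l + 1) - 2 = m - l - 2 + 1 by ring, h₂]
      linear_combination 2 * h₁ + 4 * ((l : ℝ) + 2) * h₀


/-- The key binomial identity for the characteristic polynomial of the cycle graph:
for `n ≥ 1` and `l ≤ n−1`,
`∑_{k=0}^{2n} C(2n,k)·B(k/2,l)·4^{l−n} = (2n/(2n−l))·C(2n−l,l)`,
where `B(k/2,l) = (∏_{j<l} (k/2 − j))/l!` is the generalized binomial coefficient. -/
theorem cycle_coefficient_identity (n : ℕ) (hn : 1 ≤ n) (l : ℕ) (hl : l ≤ n - 1) :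
    ∑ k ∈ Finset.range (2 * n + 1),
        ((2 * n).choose k : ℝ) *
          ((∏ j ∈ Finset.range l, ((k : ℝ) / 2 - j)) / (l.factorial : ℝ)) *
          (4 : ℝ) ^ ((l : ℤ) - (n : ℤ))
      = ((2 * n : ℝ) / ((2 * n - l : ℕ) : ℝ)) * ((2 * n - l).choose l : ℝ) := by
  have hsum : ∑ k ∈ Finset.range (2 * n + 1),
        ((2 * n).choose k : ℝ) *
          ((∏ j ∈ Finset.range l, ((k : ℝ) / 2 - j)) / (l.factorial : ℝ)) *
          (4 : ℝ) ^ ((l : ℤ) - (n : ℤ)) =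
      4 ^ l * halfFallingSum (2 * n) l / (l.factorial * 2 ^ (2 * n)) := by
    rw [halfFallingSum, Finset.mul_sum, Finset.sum_div]
    refine Finset.sum_congr rfl fun k _ => ?_
    rw [descPochhammer_eval_eq_prod_range, zpow_sub₀ four_ne_zero, zpow_natCast, zpow_natCast,
      pow_mul]
    norm_num
    field_simp
  rw [hsum]
  cases l with
  | zero =>
    have h : (n : ℝ) ≠ 0 := by positivity
    simp [halfFallingSum_zero_right, h]
  | succ l =>
    obtain ⟨N, hN⟩ : ∃ N, 2 * n - (l + 1) = N + 1 := ⟨2 * n - (l + 2), by omega⟩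
    have hN' : 2 * (n : ℝ) - l - 2 = N := by
      have h : 2 * n = N + l + 2 := by omega
      have h' : 2 * (n : ℝ) = N + l + 2 := mod_cast h
      linarith
    have hc : ((l + 1).factorial : ℝ) * ((N + 1).choose (l + 1) : ℝ) =
        (N + 1) * (descPochhammer ℝ l).eval (N : ℝ) := by
      rw [← descPochhammer_eval_add_one_succ, ← Nat.cast_add_one,
        descPochhammer_eval_eq_descFactorial, Nat.descFactorial_eq_factorial_mul_choose,
        Nat.cast_mul]
    rw [four_pow_mul_halfFallingSum_succ, hN]
    push_cast
    rw [hN']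
    have h₁ : ((l + 1).factorial : ℝ) ≠ 0 := by positivity
    have h₂ : (N : ℝ) + 1 ≠ 0 := by positivity
    field_simp
    linear_combination -hc
end
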